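/- arXiv:2406.15322 — 7 statements merged into one kernel-verified Lean document; each statement's English description precedes it below -/
import Mathlib

section
/- Let m and n be positive integers with n odd, q = 2^m, and let L(x) = Σ_{i=0}^{m-1} L_i(x^{2^i}) where each L_i is a q-linear polynomial over F_{q^n}. Then Tr(x^{q+1}) + L(x) is a permutation polynomial of F_{q^n} if and only if all three of the following hold: (1) L_i(1) ∈ F_q for all 0 ≤ i < m; (2) ℓ(x) = Σ_{i=0}^{m-1} (L_i(1)·x)^{2^{m-i}} + x^{2^{m-1}} is a permutation polynomial of F_q; (3) ker Tr ∩ ker L' = {0}. -/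
open Polynomial in
/-- A linearized polynomial of `2`-degree less than `m` vanishing on the subfield with `2 ^ m`
elements is zero. -/
theorem coeff_eq_zero_of_vanish_on_fixed {F : Type*} [Field F] [Finite F] [Algebra (ZMod 2) F]
    {m : ℕ} (hm : 0 < m) (hdvd : m ∣ Module.finrank (ZMod 2) F) (e : Fin m → F)
    (h : ∀ a : F, a ^ 2 ^ m = a → ∑ i, e i * a ^ 2 ^ (i : ℕ) = 0) (i : Fin m) : e i = 0 := by
  classical
  obtain ⟨φ⟩ := FiniteField.nonempty_algHom_of_finrank_dvd (F := ZMod 2) (K := GaloisField 2 m)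
    (L := F) (by rwa [GaloisField.finrank 2 hm.ne'])
  have := Fintype.ofFinite (GaloisField 2 m)
  have hcard : Fintype.card (GaloisField 2 m) = 2 ^ m := by
    rw [← Nat.card_eq_fintype_card, GaloisField.card 2 m hm.ne']
  have hzero : (∑ i : Fin m, C (e i) * X ^ 2 ^ (i : ℕ) : F[X]) = 0 := by
    refine eq_zero_of_natDegree_lt_card_of_eval_eq_zero _ φ.injective (fun a ↦ ?_) ?_
    · simpa [eval_finsetSum] using h (φ a) (by rw [← map_pow, ← hcard, FiniteField.pow_card])
    · rw [hcard]
      refine (natDegree_sum_le_of_forall_le (n := 2 ^ (m - 1)) _ _ fun j _ ↦ ?_).trans_lt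
        (Nat.pow_lt_pow_right one_lt_two (by omega))
      exact (natDegree_C_mul_X_pow_le _ _).trans (Nat.pow_le_pow_right two_pos (by omega))
  have := congrArg (fun p ↦ coeff p (2 ^ (i : ℕ))) hzero
  simpa [coeff_X_pow, Nat.pow_right_inj, Fin.val_inj] using this

theorem range_sup_ker_eq_top_of_ker_comp_le {K V : Type*} [Field K] [AddCommGroup V] [Module K V]
    [FiniteDimensional K V] (f p : V →ₗ[K] V)
    (h : LinearMap.ker (p ∘ₗ f) ≤ LinearMap.ker p) :
    LinearMap.range f ⊔ LinearMap.ker p = ⊤ ∧ LinearMap.ker (p ∘ₗ f) = LinearMap.ker p := by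
  have hle : LinearMap.range (p ∘ₗ f) ≤ LinearMap.range p := LinearMap.range_comp_le_range f p
  have h1 := LinearMap.finrank_range_add_finrank_ker (p ∘ₗ f)
  have h2 := LinearMap.finrank_range_add_finrank_ker p
  have h3 := Submodule.finrank_mono h
  have h4 := Submodule.finrank_mono hle
  refine ⟨?_, Submodule.eq_of_le_of_finrank_eq h (by omega)⟩
  have hr := Submodule.eq_of_le_of_finrank_eq hle (by omega)
  refine eq_top_iff.2 fun y _ ↦ ?_
  obtain ⟨x, hx⟩ : p y ∈ LinearMap.range (p ∘ₗ f) := hr ▸ LinearMap.mem_range_self p y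
  exact Submodule.mem_sup.2 ⟨f x, ⟨x, rfl⟩, y - f x,
    by simpa [sub_eq_zero] using hx.symm, by abel⟩

theorem ker_comp_eq_ker_of_range_sup_ker_eq_top {K V : Type*} [Field K] [AddCommGroup V]
    [Module K V] [FiniteDimensional K V] (f p : V →ₗ[K] V)
    (htop : LinearMap.range f ⊔ LinearMap.ker p = ⊤)
    (h : LinearMap.ker p ≤ LinearMap.ker (p ∘ₗ f)) :
    LinearMap.ker (p ∘ₗ f) = LinearMap.ker p := by
  have hr : LinearMap.range (p ∘ₗ f) = LinearMap.range p := by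
    refine le_antisymm (LinearMap.range_comp_le_range f p) ?_
    rintro _ ⟨y, rfl⟩
    obtain ⟨_, ⟨x, rfl⟩, k, hk, rfl⟩ := Submodule.mem_sup.1 (htop ▸ Submodule.mem_top (x := y))
    exact ⟨x, by simp [LinearMap.mem_ker.1 hk]⟩
  have h1 := LinearMap.finrank_range_add_finrank_ker (p ∘ₗ f)
  have h2 := LinearMap.finrank_range_add_finrank_ker p
  rw [hr] at h1
  exact (Submodule.eq_of_le_of_finrank_eq h (by omega)).symm

theorem pow_two_pow_mul_eq_self {M : Type*} [Monoid M] {m : ℕ} {a : M} (ha : a ^ 2 ^ m = a)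
    (j : ℕ) : a ^ 2 ^ (m * j) = a := by
  induction j with
  | zero => simp
  | succ j ih => rw [Nat.mul_succ, pow_add, pow_mul, ih, ha]

theorem sum_pow_two_pow {R ι : Type*} [CommSemiring R] [CharP R 2] (s : Finset ι) (f : ι → R)
    (k : ℕ) : (∑ i ∈ s, f i) ^ 2 ^ k = ∑ i ∈ s, f i ^ 2 ^ k :=
  map_sum (iterateFrobenius R 2 k) f s

section AbsoluteTrace

variable {F : Type*} [Field F] [Finite F] [Algebra (ZMod 2) F]

theorem trace_pow_two_pow (x : F) (k : ℕ) :
    Algebra.trace (ZMod 2) F (x ^ 2 ^ k) = Algebra.trace (ZMod 2) F x := by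
  induction k with
  | zero => simp
  | succ k ih =>
    rw [pow_succ, pow_mul, ← ih]
    have := Algebra.trace_eq_of_algEquiv (FiniteField.frobeniusAlgEquivOfAlgebraic (ZMod 2) F)
      (x ^ 2 ^ k)
    simpa [ZMod.card] using this

theorem eq_zero_of_forall_trace_mul_eq_zero {b : F}
    (h : ∀ x, Algebra.trace (ZMod 2) F (b * x) = 0) : b = 0 :=
  (traceForm_nondegenerate (ZMod 2) F).1 b h

end AbsoluteTrace

section RelativeTrace

variable {F : Type*} [Field F] {m n : ℕ}

/-- The trace map `x ↦ ∑ i < n, x ^ (q ^ i)` with `q = 2 ^ m`. -/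
def relTrace (m n : ℕ) (x : F) : F := ∑ i ∈ Finset.range n, x ^ (2 ^ m) ^ i

theorem relTrace_mul_of_fixed {a : F} (ha : a ^ 2 ^ m = a) (x : F) :
    relTrace m n (x * a) = relTrace m n x * a := by
  simp only [relTrace, Finset.sum_mul, mul_pow, ← pow_mul, pow_two_pow_mul_eq_self ha]

theorem trace_relTrace [Finite F] [Algebra (ZMod 2) F] (hn : Odd n) (x : F) :
    Algebra.trace (ZMod 2) F (relTrace m n x) = Algebra.trace (ZMod 2) F x := by
  have h2 : (n : ZMod 2) = 1 := (ZMod.natCast_eq_one_iff_odd).2 hn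
  simp [relTrace, ← pow_mul, trace_pow_two_pow, h2]

theorem fixed_of_fixed_sq (hn : Odd n) (hF : ∀ x : F, x ^ 2 ^ (m * n) = x) {a : F}
    (ha : (a ^ 2 ^ m) ^ 2 ^ m = a) : a ^ 2 ^ m = a := by
  obtain ⟨k, rfl⟩ := hn
  have h2 : a ^ 2 ^ (m * 2) = a := by rw [mul_two, pow_add, pow_mul, ha]
  have h := hF a
  rwa [mul_add, ← mul_assoc, mul_one, pow_add, pow_mul, pow_two_pow_mul_eq_self h2] at h

theorem relTrace_pow_card (hF : ∀ x : F, x ^ 2 ^ (m * n) = x) (x : F) :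
    relTrace m n (x ^ 2 ^ m) = relTrace m n x := by
  have h1 := Finset.sum_range_succ (fun i ↦ x ^ (2 ^ m) ^ i) n
  have h2 := Finset.sum_range_succ' (fun i ↦ x ^ (2 ^ m) ^ i) n
  rw [h1, ← pow_mul, hF, pow_zero, pow_one, add_left_inj] at h2
  rw [relTrace, relTrace, h2]
  simp only [← pow_mul x, ← pow_succ']

variable [CharP F 2]

theorem relTrace_add (x y : F) : relTrace m n (x + y) = relTrace m n x + relTrace m n y := by
  simp only [relTrace, ← pow_mul, add_pow_char_pow, Finset.sum_add_distrib]

theorem relTrace_of_fixed (hn : Odd n) {a : F} (ha : a ^ 2 ^ m = a) : relTrace m n a = a := by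
  have h2 : (n : F) = 1 := by
    obtain ⟨k, rfl⟩ := hn
    simp [CharTwo.two_eq_zero]
  simp [relTrace, ← pow_mul, pow_two_pow_mul_eq_self ha, h2]

theorem relTrace_fixed [Finite F] (hF : ∀ x : F, x ^ 2 ^ (m * n) = x) (x : F) :
    relTrace m n x ^ 2 ^ m = relTrace m n x := by
  conv_rhs => rw [← relTrace_pow_card hF]
  simp only [relTrace, sum_pow_two_pow]
  simp only [← pow_mul, mul_comm]

/-- The trace form stays nondegenerate on the subfield with `2 ^ m` elements. -/
theorem eq_zero_of_forall_fixed_trace_mul_eq_zero [Finite F] [Algebra (ZMod 2) F] (hn : Odd n)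
    (hF : ∀ x : F, x ^ 2 ^ (m * n) = x) {b : F} (hb : b ^ 2 ^ m = b)
    (h : ∀ a : F, a ^ 2 ^ m = a → Algebra.trace (ZMod 2) F (b * a) = 0) : b = 0 := by
  refine eq_zero_of_forall_trace_mul_eq_zero fun x ↦ ?_
  rw [mul_comm, ← trace_relTrace hn, relTrace_mul_of_fixed hb, mul_comm]
  exact h _ (relTrace_fixed hF x)

theorem relTrace_eq_zero_iff [Finite F] [Algebra (ZMod 2) F] (hn : Odd n)
    (hF : ∀ x : F, x ^ 2 ^ (m * n) = x) (b : F) :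
    relTrace m n b = 0 ↔ ∀ a : F, a ^ 2 ^ m = a → Algebra.trace (ZMod 2) F (b * a) = 0 := by
  refine ⟨fun h a ha ↦ ?_, fun h ↦ ?_⟩
  · rw [← trace_relTrace hn, relTrace_mul_of_fixed ha, h, zero_mul, map_zero]
  · refine eq_zero_of_forall_fixed_trace_mul_eq_zero hn hF (relTrace_fixed hF b) fun a ha ↦ ?_
    rw [← relTrace_mul_of_fixed ha, trace_relTrace hn, h a ha]

theorem relTrace_pow_add_one_add (hF : ∀ x : F, x ^ 2 ^ (m * n) = x) (x a : F) :
    relTrace m n ((x + a) ^ (2 ^ m + 1)) = relTrace m n (x ^ (2 ^ m + 1)) +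
      relTrace m n (x ^ 2 ^ m * (a + (a ^ 2 ^ m) ^ 2 ^ m)) + relTrace m n (a ^ (2 ^ m + 1)) := by
  have h : (x + a) ^ (2 ^ m + 1) =
      x ^ (2 ^ m + 1) + x ^ 2 ^ m * a + x * a ^ 2 ^ m + a ^ (2 ^ m + 1) := by
    rw [pow_succ, add_pow_char_pow]
    ring
  rw [h, mul_add, ← mul_pow]
  simp only [relTrace_add, relTrace_pow_card hF]
  ring

theorem bijective_relTrace_add_iff [Finite F] (hn : Odd n) (hF : ∀ x : F, x ^ 2 ^ (m * n) = x)
    {L : F → F} (hL : ∀ x y, L (x + y) = L x + L y) :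
    Function.Bijective (fun x ↦ relTrace m n (x ^ (2 ^ m + 1)) + L x) ↔
      (∀ a, L a ^ 2 ^ m = L a → a ^ 2 ^ m = a) ∧
        ∀ a, a ^ 2 ^ m = a → L a + a ^ 2 = 0 → a = 0 := by
  rw [← Finite.injective_iff_bijective]
  have hL0 : L 0 = 0 := by simpa using hL 0 0
  have hq : (2 : ℕ) ^ m ≠ 0 := by positivity
  have hadd (x a : F) : relTrace m n ((x + a) ^ (2 ^ m + 1)) + L (x + a) =
      (relTrace m n (x ^ (2 ^ m + 1)) + L x) +
        (relTrace m n (x ^ 2 ^ m * (a + (a ^ 2 ^ m) ^ 2 ^ m)) +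
          (relTrace m n (a ^ (2 ^ m + 1)) + L a)) := by
    rw [relTrace_pow_add_one_add hF, hL]
    ring
  have hsq {a : F} (ha : a ^ 2 ^ m = a) : relTrace m n (a ^ (2 ^ m + 1)) = a ^ 2 := by
    rw [pow_succ, ha, ← sq, relTrace_of_fixed hn (by rw [← pow_mul, mul_comm, pow_mul, ha])]
  refine ⟨fun hinj ↦ ⟨fun a hLa ↦ ?_, fun a ha h ↦ ?_⟩, fun ⟨hA, hB⟩ x z hxz ↦ ?_⟩
  · by_contra ha
    have hd : a + (a ^ 2 ^ m) ^ 2 ^ m ≠ 0 := fun h ↦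
      ha (fixed_of_fixed_sq hn hF (CharTwo.add_eq_zero.1 h).symm)
    set d := a + (a ^ 2 ^ m) ^ 2 ^ m
    set t := relTrace m n (a ^ (2 ^ m + 1)) + L a with ht
    have htf : t ^ 2 ^ m = t := by rw [ht, add_pow_char_pow, relTrace_fixed hF, hLa]
    obtain ⟨y, hy⟩ := (Finite.injective_iff_surjective.1
      (iterateFrobenius F 2 m).injective) (t / d)
    rw [iterateFrobenius_def] at hy
    have hya := @hinj (y + a) y (by
      simp only [hadd]
      rw [hy, div_mul_cancel₀ _ hd, relTrace_of_fixed hn htf, CharTwo.add_self_eq_zero, add_zero])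
    rw [add_eq_left] at hya
    exact ha (by rw [hya, zero_pow hq])
  · refine @hinj a 0 ?_
    simp only [hsq ha, hL0]
    rw [add_comm, h]
    simp [relTrace]
  · obtain ⟨a, rfl⟩ : ∃ a, z = x + a := ⟨z - x, by ring⟩
    simp only [hadd] at hxz
    have h0 := left_eq_add.1 hxz
    have hLa : L a ^ 2 ^ m = L a := by
      rw [← add_assoc, CharTwo.add_eq_zero, ← relTrace_add] at h0
      rw [← h0, relTrace_fixed hF]
    have ha := hA a hLa
    rw [ha, ha, CharTwo.add_self_eq_zero, mul_zero, hsq ha] at h0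
    have := hB a ha (by simpa [relTrace, add_comm] using h0)
    rw [this, add_zero]

end RelativeTrace

/-- Let `m, n > 0` with `n` odd, `q = 2^m`, and `F` the finite field with
`q^n = 2^(m*n)` elements.  Let `L(x) = Σ_{i<m} L_i(x^{2^i})` where each `L_i` is the `q`-linear
polynomial with coefficients `c i j`, i.e. `L_i(x) = Σ_{j<n} c i j * x^(q^j)`, so that
`L(x) = Σ_{i<m} Σ_{j<n} c i j * x^(2^(i + m*j))` and its adjoint is
`L'(x) = Σ_{i<m} Σ_{j<n} (c i j * x)^(2^(-(i+m*j))) = Σ (c i j * x)^(2^(m*n - (i+m*j)))`.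
Then `Tr(x^(q+1)) + L(x)` is a permutation polynomial of `F` iff (1) `L_i(1) ∈ F_q` for all `i`,
(2) `ℓ(x) = Σ_{i<m} (L_i(1)·x)^(2^(m-i)) + x^(2^(m-1))` permutes `F_q`, and
(3) `ker Tr ∩ ker L' = {0}`. -/
theorem stmt_0 (m n : ℕ) (hm : 0 < m) (hn : Odd n)
    (F : Type*) [Field F] [Fintype F] (hF : Fintype.card F = 2 ^ (m * n))
    (c : Fin m → Fin n → F)
    (L L' Tr ell : F → F)
    (hL : ∀ x, L x = ∑ i : Fin m, ∑ j : Fin n, c i j * x ^ 2 ^ ((i : ℕ) + m * (j : ℕ)))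
    (hL' : ∀ x, L' x = ∑ i : Fin m, ∑ j : Fin n,
        (c i j * x) ^ 2 ^ (m * n - ((i : ℕ) + m * (j : ℕ))))
    (hTr : ∀ x, Tr x = ∑ i ∈ Finset.range n, x ^ (2 ^ m) ^ i)
    (hell : ∀ x, ell x = (∑ i : Fin m, ((∑ j : Fin n, c i j) * x) ^ 2 ^ (m - (i : ℕ)))
        + x ^ 2 ^ (m - 1)) :
    Function.Bijective (fun x : F => Tr (x ^ (2 ^ m + 1)) + L x) ↔
      ((∀ i : Fin m, (∑ j : Fin n, c i j) ^ 2 ^ m = ∑ j : Fin n, c i j) ∧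
        Set.BijOn ell {x : F | x ^ 2 ^ m = x} {x : F | x ^ 2 ^ m = x} ∧
        {x : F | Tr x = 0 ∧ L' x = 0} = {0}) := by
  have hcp : CharP F 2 := charP_of_card_eq_prime_pow hF
  let : Algebra (ZMod 2) F := ZMod.algebra F 2
  have hfr : Module.finrank (ZMod 2) F = m * n := by
    have := Module.card_eq_pow_finrank (K := ZMod 2) (V := F)
    rw [hF, ZMod.card] at this
    exact (Nat.pow_right_injective le_rfl this).symm
  have hpow (x : F) : x ^ 2 ^ (m * n) = x := hF ▸ FiniteField.pow_card x
  obtain rfl : Tr = relTrace m n := funext hTr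
  have hLadd (x y : F) : L (x + y) = L x + L y := by
    simp only [hL, add_pow_char_pow, mul_add, Finset.sum_add_distrib]
  set T := Algebra.trace (ZMod 2) F with hT
  have hadj (b x : F) : T (b * L x) = T (L' b * x) := by
    simp only [hL, hL', Finset.mul_sum, Finset.sum_mul, map_sum]
    refine Finset.sum_congr rfl fun i _ ↦ Finset.sum_congr rfl fun j _ ↦ ?_
    have hle : (i : ℕ) + m * j ≤ m * n := by
      have := Nat.mul_le_mul_left m (Nat.succ_le_of_lt j.2)
      rw [Nat.mul_succ] at this
      omega
    rw [hT, ← trace_pow_two_pow _ (m * n - (i + m * j)), ← mul_assoc, mul_pow, ← pow_mul x,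
      ← pow_add, Nat.add_sub_cancel' hle, hpow, mul_comm b]
  have hLfix {a : F} (ha : a ^ 2 ^ m = a) :
      L a = ∑ i : Fin m, (∑ j : Fin n, c i j) * a ^ 2 ^ (i : ℕ) := by
    simp only [hL, Finset.sum_mul]
    refine Finset.sum_congr rfl fun i _ ↦ Finset.sum_congr rfl fun j _ ↦ ?_
    rw [add_comm, pow_add, pow_mul, pow_two_pow_mul_eq_self ha]
  have hpowfix {a : F} (ha : a ^ 2 ^ m = a) (k : ℕ) : (a ^ k) ^ 2 ^ m = a ^ k := by
    rw [← pow_mul, mul_comm, pow_mul, ha]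
  have hadjell (b : F) {a : F} (ha : a ^ 2 ^ m = a) :
      T (b * (L a + a ^ 2)) = T (ell b * a) := by
    rw [hLfix ha, hell, mul_add, add_mul, Finset.mul_sum, Finset.sum_mul, map_add, map_add, map_sum,
      map_sum]
    congr 1
    · refine Finset.sum_congr rfl fun i _ ↦ ?_
      rw [hT, ← trace_pow_two_pow _ (m - i), ← mul_assoc,
        mul_pow, ← pow_mul a, ← pow_add, Nat.add_sub_cancel' i.2.le, ha, mul_comm b]
    · rw [hT, ← trace_pow_two_pow _ (m - 1), mul_pow, ← pow_mul a, ← pow_succ',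
        Nat.sub_add_cancel hm, ha]
  let f : F →ₗ[ZMod 2] F := (AddMonoidHom.mk' L hLadd).toZModLinearMap 2
  let p : F →ₗ[ZMod 2] F :=
    (iterateFrobenius F 2 m).toAddMonoidHom.toZModLinearMap 2 - LinearMap.id
  have hp (x : F) : x ∈ LinearMap.ker p ↔ x ^ 2 ^ m = x := sub_eq_zero
  have hpf (x : F) : x ∈ LinearMap.ker (p ∘ₗ f) ↔ L x ^ 2 ^ m = L x := sub_eq_zero
  have hperp (b : F) : relTrace m n b = 0 ∧ L' b = 0 ↔
      ∀ w ∈ LinearMap.range f ⊔ LinearMap.ker p, T (b * w) = 0 := by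
    rw [relTrace_eq_zero_iff hn hpow]
    refine ⟨fun ⟨h1, h2⟩ w hw ↦ ?_, fun h ↦ ⟨fun a ha ↦ ?_, ?_⟩⟩
    · obtain ⟨_, ⟨x, rfl⟩, k, hk, rfl⟩ := Submodule.mem_sup.1 hw
      have h3 := h1 k ((hp k).1 hk)
      have h4 : T (b * f x) = 0 := (hadj b x).trans (by rw [h2, zero_mul, map_zero])
      rw [mul_add, map_add, h4, zero_add]
      exact h3
    · exact h a (Submodule.mem_sup_right ((hp a).2 ha))
    · refine eq_zero_of_forall_trace_mul_eq_zero fun x ↦ ?_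
      exact (hadj b x).symm.trans (h _ (Submodule.mem_sup_left ⟨x, rfl⟩))
  have htop : {x : F | relTrace m n x = 0 ∧ L' x = 0} = {0} ↔
      LinearMap.range f ⊔ LinearMap.ker p = ⊤ := by
    have hnd := traceForm_nondegenerate (ZMod 2) F
    have hrefl := (Algebra.traceForm_isSymm (ZMod 2) (S := F)).isRefl
    rw [Set.eq_singleton_iff_unique_mem]
    simp only [Set.mem_ofPred_eq, hperp]
    refine ⟨fun h ↦ ?_, fun h ↦ ⟨by simp, fun b hb ↦ ?_⟩⟩
    · rw [← LinearMap.BilinForm.orthogonal_orthogonal hnd hrefl (_ ⊔ _), eq_top_iff]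
      intro y _ b hb
      have hb0 : b = 0 := h.2 b fun w hw ↦ (congrArg T (mul_comm b w)).trans (hb w hw)
      simp [hb0]
    · exact eq_zero_of_forall_trace_mul_eq_zero fun x ↦ hb x (h ▸ Submodule.mem_top)
  rw [bijective_relTrace_add_iff hn hpow hLadd, htop]
  have hell0 (b : F) (h1 : ∀ i : Fin m, (∑ j : Fin n, c i j) ^ 2 ^ m = ∑ j : Fin n, c i j)
      (hb : b ^ 2 ^ m = b) : ell b ^ 2 ^ m = ell b := by
    rw [hell, add_pow_char_pow, sum_pow_two_pow, hpowfix hb]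
    congr 1
    exact Finset.sum_congr rfl fun i _ ↦ hpowfix (by rw [mul_pow, h1, hb]) _
  have helladd (x y : F) : ell (x + y) = ell x + ell y := by
    simp only [hell, add_pow_char_pow, mul_add, Finset.sum_add_distrib]
    ring
  have hellbij (h1 : ∀ i : Fin m, (∑ j : Fin n, c i j) ^ 2 ^ m = ∑ j : Fin n, c i j) :
      Set.BijOn ell {x : F | x ^ 2 ^ m = x} {x : F | x ^ 2 ^ m = x} ↔
        ∀ a : F, a ^ 2 ^ m = a → L a + a ^ 2 = 0 → a = 0 := by
    have hbij {g : F → F} (hg : ∀ x y, g (x + y) = g x + g y)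
        (hg' : Set.MapsTo g {x : F | x ^ 2 ^ m = x} {x : F | x ^ 2 ^ m = x})
        (h0 : ∀ a : F, a ^ 2 ^ m = a → g a = 0 → a = 0) :
        Set.BijOn g {x : F | x ^ 2 ^ m = x} {x : F | x ^ 2 ^ m = x} := by
      exact ((Set.toFinite _).injOn_iff_bijOn_of_mapsTo hg').1 fun x hx y hy hxy ↦
        CharTwo.add_eq_zero.1 (h0 _ (by rw [add_pow_char_pow, hx, hy])
          (by rw [hg, hxy, CharTwo.add_self_eq_zero]))
    refine ⟨fun h a ha ha0 ↦ ?_, fun h ↦ hbij helladd (fun b hb ↦ hell0 b h1 hb) ?_⟩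
    · refine eq_zero_of_forall_fixed_trace_mul_eq_zero hn hpow ha fun b hb ↦ ?_
      obtain ⟨b, -, rfl⟩ := h.surjOn hb
      rw [mul_comm, ← hT, ← hadjell b ha, ha0, mul_zero, map_zero]
    · intro b hb hb0
      have hmaps : Set.BijOn (fun a ↦ L a + a ^ 2) {x : F | x ^ 2 ^ m = x}
          {x : F | x ^ 2 ^ m = x} := by
        refine hbij (fun x y ↦ ?_) (fun a ha ↦ ?_) h
        · simp only [hLadd, CharTwo.add_sq]
          ring
        · have ha' : a ^ 2 ^ m = a := ha
          simp only [Set.mem_ofPred_eq]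
          rw [add_pow_char_pow, hpowfix ha', hLfix ha', sum_pow_two_pow]
          simp only [mul_pow, h1, hpowfix ha']
      refine eq_zero_of_forall_fixed_trace_mul_eq_zero hn hpow hb fun a ha ↦ ?_
      obtain ⟨a, ha', rfl⟩ := hmaps.surjOn ha
      exact (hadjell b ha').trans (by rw [hb0, zero_mul, map_zero])
  constructor
  · rintro ⟨hA, hB⟩
    obtain ⟨h3, hker⟩ := range_sup_ker_eq_top_of_ker_comp_le f p fun x hx ↦
      (hp x).2 (hA x ((hpf x).1 hx))
    have h1 (i : Fin m) : (∑ j : Fin n, c i j) ^ 2 ^ m = ∑ j : Fin n, c i j := by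
      refine sub_eq_zero.1 (coeff_eq_zero_of_vanish_on_fixed hm (hfr ▸ dvd_mul_right m n)
        (fun i ↦ (∑ j : Fin n, c i j) ^ 2 ^ m - ∑ j : Fin n, c i j) (fun a ha ↦ ?_) i)
      have h := (hpf a).1 (hker ▸ (hp a).2 ha)
      rw [hLfix ha, sum_pow_two_pow] at h
      simp only [mul_pow, hpowfix ha] at h
      simp only [sub_mul, Finset.sum_sub_distrib, h, sub_self]
    exact ⟨h1, (hellbij h1).2 hB, h3⟩
  · rintro ⟨h1, h2, h3⟩
    refine ⟨fun a ha ↦ ?_, (hellbij h1).1 h2⟩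
    have hker := ker_comp_eq_ker_of_range_sup_ker_eq_top f p h3 fun a ha ↦ (hpf a).2 (by
      have ha' := (hp a).1 ha
      rw [hLfix ha', sum_pow_two_pow]
      simp only [mul_pow, h1, hpowfix ha'])
    exact (hp a).1 (hker ▸ (hpf a).2 ha)
end

section
/- Let L(x) = a·x^{2^k} + b·x^{2^l} be a nonzero polynomial with a, b ∈ F_{q^n} and nonnegative integers k, l. Set d = gcd(l-k, mn), e = gcd(l-k, m), and r = d/e. If a^{(q^n-1)/(2^d-1)} ≠ b^{(q^n-1)/(2^d-1)}, then |ker Tr ∩ ker L'| = 1. Assuming a^{(q^n-1)/(2^d-1)} = b^{(q^n-1)/(2^d-1)}: (1) when k ≡ l (mod m) and a + b ∈ F_q, |ker Tr ∩ ker L'| = 2^d if a + b ≠ 0, or if a + b = 0 and Tr_r(a^{-1}) = 0; and |ker Tr ∩ ker L'| = q^{r-1} otherwise; (2) when k ≢ l (mod m) and a, b ∈ F_q, |ker Tr ∩ ker L'| = 2^d if a^{(q-1)/(2^e-1)} ≠ b^{(q-1)/(2^e-1)} or n/r is even, and |ker Tr ∩ ker L'| = 2^{d-e} otherwise. -/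
/-- The polynomial function `x ↦ ∑_{i<r} x^(2^(e i))`. -/
def trSum {F : Type*} [Field F] (e r : ℕ) (x : F) : F :=
  ∑ i ∈ Finset.range r, x ^ (2 ^ e) ^ i

section
variable {F : Type*} [Field F]

theorem pow_two_pow_gcd_eq_self {u : F} {s t : ℕ} (hs : u ^ 2 ^ s = u) (ht : u ^ 2 ^ t = u) :
    u ^ 2 ^ Nat.gcd s t = u := by
  have h (j : ℕ) : Function.IsPeriodicPt (fun x : F => x ^ 2) j u ↔ u ^ 2 ^ j = u := by
    rw [Function.IsPeriodicPt, Function.IsFixedPt, pow_iterate]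
  exact (h _).1 (((h s).2 hs).gcd ((h t).2 ht))

theorem pow_two_pow_eq_self_of_dvd {u : F} {s t : ℕ} (hs : u ^ 2 ^ s = u) (hst : s ∣ t) :
    u ^ 2 ^ t = u := by
  obtain ⟨j, rfl⟩ := hst
  induction j with
  | zero => simp
  | succ j ih => rw [Nat.mul_succ, pow_add, pow_mul, ih, hs]

theorem trSum_zero (e r : ℕ) : trSum e r (0 : F) = 0 := by
  simp [trSum]

theorem trSum_mul_of_fixed {e : ℕ} {z : F} (hz : z ^ 2 ^ e = z) (r : ℕ) (x : F) :
    trSum e r (z * x) = z * trSum e r x := by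
  rw [trSum, trSum, Finset.mul_sum]
  refine Finset.sum_congr rfl fun i _ => ?_
  rw [mul_pow, ← pow_mul, pow_two_pow_eq_self_of_dvd hz (Dvd.intro _ rfl)]

theorem trSum_pow_self {e r : ℕ} {x : F} (hx : x ^ 2 ^ (e * r) = x) :
    trSum e r (x ^ 2 ^ e) = trSum e r x := by
  have h1 : trSum e r (x ^ 2 ^ e) = ∑ i ∈ Finset.range r, x ^ (2 ^ e) ^ (i + 1) :=
    Finset.sum_congr rfl fun i _ => by rw [← pow_mul, ← pow_succ']
  have h2 := Finset.sum_range_succ (fun i => x ^ (2 ^ e) ^ i) r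
  rw [Finset.sum_range_succ', ← pow_mul 2 e r, hx] at h2
  rw [h1]
  simpa [trSum] using h2

theorem trSum_pow_of_dvd {e r s : ℕ} (hs : e ∣ s) {x : F} (hx : x ^ 2 ^ (e * r) = x) :
    trSum e r (x ^ 2 ^ s) = trSum e r x := by
  obtain ⟨j, rfl⟩ := hs
  induction j with
  | zero => simp
  | succ j ih =>
    rw [Nat.mul_succ, pow_add, pow_mul, trSum_pow_self, ih]
    rw [← pow_mul, mul_comm, pow_mul, hx]

theorem sum_range_mul_of_coprime {M : Type*} [AddCommMonoid M] {f : ℕ → M} {g r : ℕ}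
    (hr : 0 < r) (hf : ∀ i, f (i % r) = f i) (hg : Nat.Coprime g r) :
    ∑ i ∈ Finset.range r, f (g * i) = ∑ i ∈ Finset.range r, f i := by
  have hmaps : Set.MapsTo (fun i => g * i % r) (Finset.range r) (Finset.range r) := fun i _ => by
    simpa using Nat.mod_lt _ hr
  have hinj : Set.InjOn (fun i => g * i % r) (Finset.range r) := fun i hi j hj hij => by
    have h : i ≡ j [MOD r] := Nat.ModEq.cancel_left_of_coprime hg.symm hij
    simp only [Finset.coe_range, Set.mem_Iio] at hi hj
    exact h.eq_of_lt_of_lt hi hj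
  exact Finset.sum_nbij (fun i => g * i % r) hmaps hinj
    (Finset.surjOn_of_injOn_of_card_le _ hmaps hinj le_rfl) fun i _ => (hf _).symm

theorem trSum_mul_left_of_coprime {e r g : ℕ} (hr : 0 < r) (hg : Nat.Coprime g r) {u : F}
    (hu : u ^ 2 ^ (e * r) = u) : trSum (e * g) r u = trSum e r u := by
  have h := sum_range_mul_of_coprime (f := fun i => u ^ (2 ^ e) ^ i) hr (fun i => ?_) hg
  · rw [trSum, trSum, ← h]
    exact Finset.sum_congr rfl fun i _ => by rw [pow_mul, pow_mul]
  · conv_rhs => rw [← Nat.div_add_mod i r, pow_add, pow_mul, ← pow_mul 2 e,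
      pow_two_pow_eq_self_of_dvd hu (Dvd.intro (i / r) (mul_assoc _ _ _))]

theorem exists_pow_eq_of_pow_eq_one {G : Type*} [CommGroup G] [IsCyclic G] [Finite G]
    {Q T : ℕ} (hQ : Q ∣ Nat.card G) {c : G} (hc : c ^ (Q / Nat.gcd T Q) = 1) :
    ∃ y : G, y ^ Q = 1 ∧ y ^ T = c := by
  obtain ⟨g, hg⟩ := IsCyclic.exists_generator (α := G)
  obtain ⟨j, rfl⟩ := (Subgroup.mem_zpowers_iff).1 (hg c)
  obtain ⟨w, hw⟩ := hQ
  have hord : orderOf g = Q * w := by rw [orderOf_eq_card_of_forall_mem_zpowers hg, hw]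
  have hpos : 0 < Q * w := hw ▸ Nat.card_pos
  have hQ0 : 0 < Q := Nat.pos_of_mul_pos_right hpos
  have hone : g ^ ((Q : ℤ) * w) = 1 := by
    have := pow_orderOf_eq_one g
    rw [hord] at this
    exact_mod_cast this
  set D := Nat.gcd T Q with hD
  obtain ⟨Q', hQ'⟩ : D ∣ Q := Nat.gcd_dvd_right T Q
  have hD0 : 0 < D := Nat.gcd_pos_of_pos_right _ hQ0
  have hQ'0 : 0 < Q' := by
    rcases Nat.eq_zero_or_pos Q' with h | h
    · simp [h] at hQ'; omega
    · exact h
  have hdvd : ((Q * w : ℕ) : ℤ) ∣ j * (Q' : ℕ) := by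
    rw [← hord]
    rw [orderOf_dvd_iff_zpow_eq_one]
    rw [hQ', Nat.mul_div_cancel_left _ hD0] at hc
    rw [zpow_mul]
    exact_mod_cast hc
  obtain ⟨i, hi⟩ : ((D * w : ℕ) : ℤ) ∣ j := by
    obtain ⟨i, hi⟩ := hdvd
    refine ⟨i, ?_⟩
    have h0 : (Q' : ℤ) ≠ 0 := by exact_mod_cast hQ'0.ne'
    apply mul_right_cancel₀ h0
    rw [hi, hQ']; push_cast; ring
  have hbez := Nat.gcd_eq_gcd_ab T Q
  rw [← hD] at hbez
  refine ⟨g ^ ((w : ℤ) * Nat.gcdA T Q * i), ?_, ?_⟩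
  · rw [← zpow_natCast, ← zpow_mul,
      show (w : ℤ) * Nat.gcdA T Q * i * Q = Q * w * (Nat.gcdA T Q * i) by ring, zpow_mul, hone,
      one_zpow]
  · rw [← zpow_natCast, ← zpow_mul, hi]
    push_cast
    rw [hbez, show ((T : ℤ) * Nat.gcdA T Q + Q * Nat.gcdB T Q) * w * i =
      w * Nat.gcdA T Q * i * T + Q * w * (Nat.gcdB T Q * i) by ring, zpow_add, zpow_mul g (Q * w),
      hone, one_zpow, mul_one]

theorem pow_eq_one_of_pow_two_pow_eq {c y : F} {m t : ℕ} (hy : y ≠ 0)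
    (hm : y ^ 2 ^ m = y) (ht : y ^ 2 ^ t = c * y) :
    c ^ ((2 ^ m - 1) / (2 ^ Nat.gcd t m - 1)) = 1 := by
  have key (s : ℕ) : y ^ 2 ^ s = y ^ (2 ^ s - 1) * y := by
    rw [← pow_succ, Nat.sub_add_cancel Nat.one_le_two_pow]
  have hc : c = y ^ (2 ^ t - 1) := mul_right_cancel₀ hy (by rw [← ht, key])
  have h1 : y ^ (2 ^ m - 1) = 1 := mul_right_cancel₀ hy (by rw [← key, hm, one_mul])
  obtain ⟨w, hw⟩ : 2 ^ Nat.gcd t m - 1 ∣ 2 ^ t - 1 :=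
    Nat.pow_sub_one_dvd_pow_sub_one 2 (Nat.gcd_dvd_left t m)
  have hd : 2 ^ Nat.gcd t m - 1 ∣ 2 ^ m - 1 :=
    Nat.pow_sub_one_dvd_pow_sub_one 2 (Nat.gcd_dvd_right t m)
  rw [hc, ← pow_mul, hw, mul_right_comm, Nat.mul_div_cancel' hd, pow_mul, h1, one_pow]

theorem exists_pow_two_pow_eq [Finite F] {m N t : ℕ} (hF : Nat.card F = 2 ^ N) (hm : m ∣ N)
    {c : F} (hc0 : c ≠ 0)
    (hc : c ^ ((2 ^ m - 1) / (2 ^ Nat.gcd t m - 1)) = 1) :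
    ∃ y : F, y ≠ 0 ∧ y ^ 2 ^ m = y ∧ y ^ 2 ^ t = c * y := by
  have key (y : F) (s : ℕ) : y ^ 2 ^ s = y ^ (2 ^ s - 1) * y := by
    rw [← pow_succ, Nat.sub_add_cancel Nat.one_le_two_pow]
  have hQ : 2 ^ m - 1 ∣ Nat.card Fˣ := by
    rw [Nat.card_units, hF]
    exact Nat.pow_sub_one_dvd_pow_sub_one 2 hm
  obtain ⟨y, hy1, hy2⟩ := exists_pow_eq_of_pow_eq_one (T := 2 ^ t - 1) (c := Units.mk0 c hc0) hQ
    (by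
      rw [Nat.pow_sub_one_gcd_pow_sub_one]
      ext
      simpa using hc)
  refine ⟨y, y.ne_zero, ?_, ?_⟩
  · rw [key, ← Units.val_pow_eq_pow_val, hy1, Units.val_one, one_mul]
  · rw [key, ← Units.val_pow_eq_pow_val, hy2, Units.val_mk0]

open Polynomial in
theorem card_trSum_fiber_le [Finite F] {e r : ℕ} (he : 0 < e) (hr : 0 < r) (a : F) :
    Nat.card {x : F // trSum e r x = a} ≤ 2 ^ (e * (r - 1)) := by
  classical
  set P : F[X] := ∑ i ∈ Finset.range r, X ^ (2 ^ e) ^ i - C a with hP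
  have h2 : 1 < 2 ^ e := Nat.one_lt_two_pow he.ne'
  have hdeg : P.natDegree ≤ 2 ^ (e * (r - 1)) := by
    rw [pow_mul]
    refine (natDegree_sub_C).trans_le (natDegree_sum_le_of_forall_le _ _ fun i hi => ?_)
    rw [natDegree_X_pow]
    have := Finset.mem_range.1 hi
    exact Nat.pow_le_pow_right (by omega) (by omega)
  have hcoeff : P.coeff ((2 ^ e) ^ (r - 1)) = 1 := by
    rw [hP, coeff_sub, coeff_C, if_neg (by positivity), sub_zero, finsetSum_coeff,
      Finset.sum_eq_single (r - 1)]
    · simp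
    · intro i _ hi
      rw [coeff_X_pow, if_neg]
      exact fun h => hi (Nat.pow_right_injective h2 h).symm
    · intro h; simp at h; omega
  have hP0 : P ≠ 0 := fun h => by simp [h] at hcoeff
  have hsub : {x : F | trSum e r x = a} ⊆ (P.roots.toFinset : Set F) := fun x hx => by
    simp only [Set.mem_ofPred_eq, trSum] at hx
    rw [Finset.mem_coe, Multiset.mem_toFinset, mem_roots hP0]
    simp [hP, eval_finsetSum, hx]
  calc Nat.card {x : F // trSum e r x = a} = Set.ncard {x : F | trSum e r x = a} := rfl
    _ ≤ (P.roots.toFinset : Set F).ncard := Set.ncard_le_ncard hsub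
    _ = P.roots.toFinset.card := Set.ncard_coe_finset _
    _ ≤ P.natDegree := (Multiset.toFinset_card_le _).trans (card_roots' P)
    _ ≤ _ := hdeg

theorem gcd_div_facts {m n t d e r : ℕ} (hm : 0 < m) (hd : d = Nat.gcd t (m * n))
    (he : e = Nat.gcd t m) (hr : r = d / e) :
    d = e * r ∧ r ∣ n ∧ ∃ g, m = e * g ∧ Nat.Coprime g r := by
  obtain ⟨t', g, hcop, ht, hg⟩ := Nat.exists_coprime t m
  rw [← he] at ht hg
  have he0 : 0 < e := he ▸ Nat.gcd_pos_of_pos_right _ hm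
  have hd' : d = e * Nat.gcd t' n := by
    rw [hd, ht, hg, mul_comm t', mul_comm g, mul_assoc, Nat.gcd_mul_left,
      Nat.Coprime.gcd_mul_left_cancel_right n hcop.symm]
  have hr' : r = Nat.gcd t' n := by rw [hr, hd', Nat.mul_div_cancel_left _ he0]
  refine ⟨hr' ▸ hd', hr' ▸ Nat.gcd_dvd_right _ _, g, by rw [mul_comm, ← hg], ?_⟩
  exact hr' ▸ (hcop.coprime_dvd_left (Nat.gcd_dvd_left t' n)).symm

theorem card_subtype_mul_left {w : F} (hw : w ≠ 0) {p q : F → Prop}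
    (h : ∀ u, q u ↔ p (w * u)) : Nat.card {x // p x} = Nat.card {x // q x} :=
  (Nat.card_congr ((Equiv.mulLeft₀ w hw).subtypeEquiv h)).symm

theorem pow_two_pow_eq_self_iff {t d N : ℕ} (hd : d = Nat.gcd t N) (hF : Nat.card F = 2 ^ N)
    [Finite F] (u : F) : u ^ 2 ^ t = u ↔ u ^ 2 ^ d = u := by
  have := Fintype.ofFinite F
  subst hd
  refine ⟨fun h => pow_two_pow_gcd_eq_self h ?_,
    fun h => pow_two_pow_eq_self_of_dvd h (Nat.gcd_dvd_left _ _)⟩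
  rw [← hF, Nat.card_eq_fintype_card, FiniteField.pow_card]

theorem mul_mem_ker_iff {a b z : F} (hb : b ≠ 0) (hz0 : z ≠ 0) {t : ℕ}
    (hz : (a * z) ^ 2 ^ t = b * z) (u : F) :
    (a * (z * u)) ^ 2 ^ t = b * (z * u) ↔ u ^ 2 ^ t = u := by
  rw [← mul_assoc, mul_pow, hz, ← mul_assoc, mul_right_inj' (mul_ne_zero hb hz0)]

theorem exists_ker_ne_zero [Finite F] {m N t : ℕ} (hF : Nat.card F = 2 ^ N) (hm : m ∣ N)
    {a b : F} (ha : a ≠ 0) (hb : b ≠ 0) (ham : a ^ 2 ^ m = a)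
    (h : a ^ ((2 ^ m - 1) / (2 ^ Nat.gcd t m - 1)) = b ^ ((2 ^ m - 1) / (2 ^ Nat.gcd t m - 1))) :
    ∃ z : F, z ≠ 0 ∧ z ^ 2 ^ m = z ∧ (a * z) ^ 2 ^ t = b * z := by
  obtain ⟨y, hy0, hym, hyt⟩ := exists_pow_two_pow_eq (t := t) hF hm (div_ne_zero hb ha)
    (by rw [div_pow, h, div_self (pow_ne_zero _ hb)])
  refine ⟨y / a, div_ne_zero hy0 ha, by rw [div_pow, hym, ham], ?_⟩
  rw [mul_div_cancel₀ _ ha, hyt]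
  ring

theorem pow_eq_pow_of_mem_ker {m t : ℕ} {a b z : F} (ha : a ≠ 0) (hz0 : z ≠ 0)
    (ham : a ^ 2 ^ m = a) (hzm : z ^ 2 ^ m = z) (hz : (a * z) ^ 2 ^ t = b * z) :
    a ^ ((2 ^ m - 1) / (2 ^ Nat.gcd t m - 1)) = b ^ ((2 ^ m - 1) / (2 ^ Nat.gcd t m - 1)) := by
  have h := pow_eq_one_of_pow_two_pow_eq (c := b / a) (mul_ne_zero ha hz0)
    (by rw [mul_pow, ham, hzm]) (by rw [hz]; field_simp)
  rw [div_pow, div_eq_one_iff_eq (pow_ne_zero _ ha)] at h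
  exact h.symm

variable [CharP F 2]

theorem trSum_pow (e r s : ℕ) (x : F) : trSum e r x ^ 2 ^ s = trSum e r (x ^ 2 ^ s) := by
  rw [trSum, trSum, sum_pow_char_pow]
  exact Finset.sum_congr rfl fun i _ => by
    rw [← pow_mul, ← pow_mul, ← pow_mul, mul_comm]

theorem trSum_add (e r : ℕ) (x y : F) : trSum e r (x + y) = trSum e r x + trSum e r y := by
  rw [trSum, trSum, trSum, ← Finset.sum_add_distrib]
  exact Finset.sum_congr rfl fun i _ => by rw [← pow_mul, add_pow_char_pow]

theorem trSum_fixed {e r : ℕ} {x : F} (hx : x ^ 2 ^ (e * r) = x) :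
    trSum e r x ^ 2 ^ e = trSum e r x := by
  rw [trSum_pow, trSum_pow_self hx]

theorem trSum_mul_right (m r w : ℕ) (x : F) :
    trSum m (r * w) x = trSum m r (trSum (m * r) w x) := by
  have h (i : ℕ) : trSum (m * r) w x ^ (2 ^ m) ^ i =
      ∑ j ∈ Finset.range w, x ^ (2 ^ m) ^ (i + r * j) := by
    rw [← pow_mul, trSum_pow, trSum]
    exact Finset.sum_congr rfl fun j _ => by simp only [← pow_mul, ← pow_add]; ring_nf
  rw [trSum, trSum, Finset.sum_congr rfl fun i _ => h i]
  clear h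
  induction w with
  | zero => simp
  | succ w ih =>
    simp only [Finset.sum_range_succ, Finset.sum_add_distrib, ← ih]
    rw [Nat.mul_succ, Finset.sum_range_add]
    simp only [add_comm]

theorem card_fixed_and_card_trSum_ker [Finite F] {e r : ℕ} (he : 0 < e) (hr : 0 < r)
    (hd : Nat.card {u : F // u ^ 2 ^ (e * r) = u} = 2 ^ (e * r)) :
    Nat.card {u : F // u ^ 2 ^ e = u} = 2 ^ e ∧
      Nat.card {u : F // u ^ 2 ^ (e * r) = u ∧ trSum e r u = 0} = 2 ^ (e * (r - 1)) := by
  classical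
  have := Fintype.ofFinite F
  have hle : Nat.card {u : F // u ^ 2 ^ e = u} ≤ 2 ^ e := by
    have h := card_trSum_fiber_le (F := F) (r := 2) he (by norm_num) 0
    simp only [trSum, Finset.sum_range_succ, Finset.sum_range_zero, pow_zero, pow_one, zero_add,
      CharTwo.add_eq_zero, Nat.add_one_sub_one, mul_one] at h
    simpa only [eq_comm] using h
  have hfib (a : F) := card_trSum_fiber_le he hr a
  simp only [Nat.card_eq_fintype_card, Fintype.card_subtype] at *
  set V : Finset F := {u : F | u ^ 2 ^ (e * r) = u} with hV
  set W : Finset F := {u : F | u ^ 2 ^ e = u} with hW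
  have hcard : V.card = ∑ a ∈ W, (V.filter fun u => trSum e r u = a).card :=
    Finset.card_eq_sum_card_fiberwise fun u hu => by
      simp only [hV, hW, Finset.coe_filter, Finset.mem_univ, true_and, Set.mem_ofPred_eq] at hu ⊢
      exact trSum_fixed hu
  have hfib' (a : F) : (V.filter fun u => trSum e r u = a).card ≤ 2 ^ (e * (r - 1)) :=
    (Finset.card_le_card (Finset.filter_subset_filter _ (Finset.subset_univ _))).trans (hfib a)
  have hprod : 2 ^ (e * r) = 2 ^ e * 2 ^ (e * (r - 1)) := by
    rw [← pow_add]
    congr 1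
    obtain ⟨j, rfl⟩ := Nat.exists_eq_succ_of_ne_zero hr.ne'
    simp [Nat.mul_succ, add_comm]
  have hsum : ∑ a ∈ W, (V.filter fun u => trSum e r u = a).card ≤ W.card * 2 ^ (e * (r - 1)) :=
    Finset.sum_le_card_nsmul _ _ _ fun a _ => hfib' a
  have hpos : 0 < 2 ^ (e * (r - 1)) := by positivity
  have hWc : W.card = 2 ^ e := by
    refine le_antisymm hle ?_
    rw [← hcard, hd, hprod] at hsum
    exact Nat.le_of_mul_le_mul_right hsum hpos
  refine ⟨hWc, ?_⟩
  rw [← Finset.filter_filter]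
  refine le_antisymm (hfib' 0) (not_lt.1 fun hlt => ?_)
  have : ∑ a ∈ W, (V.filter fun u => trSum e r u = a).card < W.card * 2 ^ (e * (r - 1)) := by
    rw [← smul_eq_mul, ← Finset.sum_const]
    exact Finset.sum_lt_sum (fun a _ => hfib' a) ⟨0, by simp [hW], hlt⟩
  rw [← hcard, hd, hWc, ← hprod] at this
  exact lt_irrefl _ this

theorem card_fixed [Finite F] {d N : ℕ} (hN : 0 < N) (hF : Nat.card F = 2 ^ N) (hd : d ∣ N) :
    Nat.card {u : F // u ^ 2 ^ d = u} = 2 ^ d := by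
  have := Fintype.ofFinite F
  obtain ⟨w, rfl⟩ := hd
  refine (card_fixed_and_card_trSum_ker (Nat.pos_of_mul_pos_right hN)
    (Nat.pos_of_mul_pos_left hN) ?_).1
  refine (Nat.card_congr (Equiv.subtypeUnivEquiv fun u => ?_)).trans hF
  rw [← hF, Nat.card_eq_fintype_card, FiniteField.pow_card]

theorem card_trSum_ker [Finite F] {e r N : ℕ} (hN : 0 < N) (hF : Nat.card F = 2 ^ N)
    (hd : e * r ∣ N) :
    Nat.card {u : F // u ^ 2 ^ (e * r) = u ∧ trSum e r u = 0} = 2 ^ (e * (r - 1)) := by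
  have h := Nat.pos_of_dvd_of_pos hd hN
  exact (card_fixed_and_card_trSum_ker (Nat.pos_of_mul_pos_right h)
    (Nat.pos_of_mul_pos_left h) (card_fixed hN hF hd)).2

theorem card_ker [Finite F] {t d N : ℕ} (hN : 0 < N) (hF : Nat.card F = 2 ^ N)
    (hd : d = Nat.gcd t N) {a b z : F} (hb : b ≠ 0) (hz0 : z ≠ 0)
    (hz : (a * z) ^ 2 ^ t = b * z) :
    Nat.card {x : F // (a * x) ^ 2 ^ t = b * x} = 2 ^ d := by
  rw [card_subtype_mul_left hz0 fun u => (mul_mem_ker_iff hb hz0 hz u).symm]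
  simp only [pow_two_pow_eq_self_iff hd hF]
  exact card_fixed hN hF (hd.dvd.trans (Nat.gcd_dvd_right t N))

theorem card_trSum_ker_of_forall [Finite F] {t d N m n : ℕ} (hN : 0 < N) (hF : Nat.card F = 2 ^ N)
    (hd : d = Nat.gcd t N) {a b z : F} (hb : b ≠ 0) (hz0 : z ≠ 0)
    (hz : (a * z) ^ 2 ^ t = b * z)
    (h : ∀ x : F, (a * x) ^ 2 ^ t = b * x → trSum m n x = 0) :
    Nat.card {x : F // trSum m n x = 0 ∧ (a * x) ^ 2 ^ t = b * x} = 2 ^ d := by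
  rw [← card_ker hN hF hd hb hz0 hz]
  exact Nat.card_congr (Equiv.subtypeEquivRight fun x => ⟨fun hx => hx.2, fun hx => ⟨h x hx, hx⟩⟩)

theorem trSum_eq_zero_of_add_fixed {m n t : ℕ} {a b x : F} (ht : m ∣ t)
    (hab : (a + b) ^ 2 ^ m = a + b) (hab0 : a + b ≠ 0)
    (hax : (a * x) ^ 2 ^ (m * n) = a * x) (hx : (a * x) ^ 2 ^ t = b * x) :
    trSum m n x = 0 := by
  have h : trSum m n (a * x) = trSum m n (b * x) := by
    rw [← hx, trSum_pow_of_dvd ht hax]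
  rw [← CharTwo.add_eq_zero, ← trSum_add, ← add_mul, trSum_mul_of_fixed hab] at h
  exact (mul_eq_zero.1 h).resolve_left hab0

theorem trSum_inv_mul {m r w : ℕ} {a u : F} (hu : u ^ 2 ^ (m * r) = u) :
    trSum m (r * w) (a⁻¹ * u) = trSum m r (trSum (m * r) w a⁻¹ * u) := by
  rw [trSum_mul_right, mul_comm a⁻¹, trSum_mul_of_fixed hu, mul_comm u]

theorem trSum_of_fixed {e g r w : ℕ} (hr : 0 < r) (hg : Nat.Coprime g r) {u : F}
    (hu : u ^ 2 ^ (e * r) = u) :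
    trSum (e * g) (r * w) u = w * trSum e r u := by
  have hw : trSum (e * g * r) w u = w * u := by
    rw [trSum, Finset.sum_congr rfl fun i _ => ?_, Finset.sum_const, Finset.card_range,
      nsmul_eq_mul]
    rw [← pow_mul, pow_two_pow_eq_self_of_dvd hu ⟨g * i, by ring⟩]
  have hwf (s : ℕ) : (w : F) ^ 2 ^ s = w := by
    rcases Nat.even_or_odd w with h | h
    · simp [CharTwo.natCast_eq_ite, h]
    · simp [CharTwo.natCast_eq_ite, Nat.not_even_iff_odd.2 h]
  rw [trSum_mul_right, hw, trSum_mul_of_fixed (hwf _), trSum_mul_left_of_coprime hr hg hu]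

theorem card_trSum_ker_eq [Finite F] {m n t r : ℕ} (hm : 0 < m) (hn : 0 < n)
    (hF : Nat.card F = 2 ^ (m * n)) (hd : m * r = Nat.gcd t (m * n)) (hr : r ∣ n)
    {a : F} (ha : a ≠ 0) (hw : trSum (m * r) (n / r) a⁻¹ ≠ 0) :
    Nat.card {x : F // trSum m n x = 0 ∧ (a * x) ^ 2 ^ t = a * x} = 2 ^ (m * (r - 1)) := by
  have := Fintype.ofFinite F
  have hN : 0 < m * n := Nat.mul_pos hm hn
  rw [← card_trSum_ker hN hF (hd ▸ Nat.gcd_dvd_right t _)]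
  set w := trSum (m * r) (n / r) a⁻¹ with hw_def
  have hwf : w ^ 2 ^ (m * r) = w := trSum_fixed (by
    rw [mul_assoc, Nat.mul_div_cancel' hr, ← hF, Nat.card_eq_fintype_card, FiniteField.pow_card])
  refine card_subtype_mul_left (w := (a * w)⁻¹) (inv_ne_zero (mul_ne_zero ha hw)) fun u => ?_
  have h1 : a * ((a * w)⁻¹ * u) = w⁻¹ * u := by field_simp
  have h2 : (w⁻¹ * u) ^ 2 ^ (m * r) = w⁻¹ * u ↔ u ^ 2 ^ (m * r) = u := by
    rw [mul_pow, inv_pow, hwf, mul_right_inj' (inv_ne_zero hw)]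
  rw [h1, pow_two_pow_eq_self_iff hd hF, h2, and_comm]
  refine and_congr_left fun hu => ?_
  have h3 : trSum m n ((a * w)⁻¹ * u) = trSum m r u := by
    have h := trSum_inv_mul (w := n / r) (a := a) (h2.2 hu)
    rw [Nat.mul_div_cancel' hr, ← hw_def, mul_inv_cancel_left₀ hw] at h
    rw [← h, mul_inv, mul_assoc]
  rw [h3]

theorem card_trSum_ker_of_mem_ker [Finite F] {e g n t r : ℕ} (hN : 0 < e * g * n)
    (hF : Nat.card F = 2 ^ (e * g * n)) (hd : e * r = Nat.gcd t (e * g * n)) (hr : r ∣ n)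
    (hg : Nat.Coprime g r) {a b z : F} (hb : b ≠ 0) (hz0 : z ≠ 0) (hzm : z ^ 2 ^ (e * g) = z)
    (hz : (a * z) ^ 2 ^ t = b * z) :
    (Even (n / r) →
      Nat.card {x : F // trSum (e * g) n x = 0 ∧ (a * x) ^ 2 ^ t = b * x} = 2 ^ (e * r)) ∧
    (¬ Even (n / r) →
      Nat.card {x : F // trSum (e * g) n x = 0 ∧ (a * x) ^ 2 ^ t = b * x} =
        2 ^ (e * (r - 1))) := by
  have hr0 : 0 < r := Nat.pos_of_dvd_of_pos hr (Nat.pos_of_mul_pos_left hN)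
  have hdN : e * r ∣ e * g * n := hd ▸ Nat.gcd_dvd_right t _
  have hTr (u : F) (hu : u ^ 2 ^ (e * r) = u) :
      trSum (e * g) n (z * u) = z * ((n / r : ℕ) * trSum e r u) := by
    rw [trSum_mul_of_fixed hzm, ← trSum_of_fixed hr0 hg hu, Nat.mul_div_cancel' hr]
  constructor
  · intro h
    rw [← card_fixed hN hF hdN]
    refine card_subtype_mul_left hz0 fun u => ?_
    rw [mul_mem_ker_iff hb hz0 hz, pow_two_pow_eq_self_iff hd hF]
    refine ⟨fun hu => ⟨?_, hu⟩, fun hu => hu.2⟩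
    rw [hTr u hu, CharTwo.natCast_eq_ite, if_pos h, zero_mul, mul_zero]
  · intro h
    rw [← card_trSum_ker hN hF hdN]
    refine card_subtype_mul_left hz0 fun u => ?_
    rw [mul_mem_ker_iff hb hz0 hz, pow_two_pow_eq_self_iff hd hF, and_comm]
    refine and_congr_left fun hu => ?_
    rw [hTr u hu, CharTwo.natCast_eq_ite, if_neg h, one_mul,
      mul_eq_zero, or_iff_right hz0]

theorem adjoint_eq_zero_iff [Finite F] {N k l : ℕ} (hN : 0 < N) (hF : Nat.card F = 2 ^ N)
    (y z : F) :
    y ^ 2 ^ (N - k % N) + z ^ 2 ^ (N - l % N) = 0 ↔ y ^ 2 ^ (N - k % N + l % N) = z := by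
  have := Fintype.ofFinite F
  have hz : (z ^ 2 ^ (N - l % N)) ^ 2 ^ (l % N) = z := by
    rw [← pow_mul, ← pow_add, Nat.sub_add_cancel (Nat.mod_lt _ hN).le, ← hF,
      Nat.card_eq_fintype_card, FiniteField.pow_card]
  rw [CharTwo.add_eq_zero, ← (iterateFrobenius F 2 (l % N)).injective.eq_iff]
  simp only [iterateFrobenius_def]
  rw [hz, ← pow_mul, ← pow_add]

end

theorem Int.gcd_sub_eq_natGcd {N k l M : ℕ} (hN : 0 < N) (hM : M ∣ N) :
    Int.gcd ((l : ℤ) - (k : ℤ)) (M : ℤ) = Nat.gcd (N - k % N + l % N) M := by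
  have hk := (Nat.mod_lt k hN).le
  have h1 := Int.mul_ediv_add_emod k N
  have h2 := Int.mul_ediv_add_emod l N
  obtain ⟨w, hw⟩ := hM
  have h : (l : ℤ) - k = ((N - k % N + l % N : ℕ) : ℤ) + M * (w * (l / N - k / N - 1)) := by
    have hw' : (N : ℤ) = M * w := by exact_mod_cast hw
    rw [← mul_assoc, ← hw']
    push_cast [Nat.cast_sub hk]
    linear_combination -h2 + h1
  rw [h, Int.gcd_add_mul_left_left, Int.gcd_natCast_natCast]

/-- Let `q = 2^m`, `F` the field with `q^n` elements, and
`L(x) = a·x^(2^k) + b·x^(2^l)` nonzero.  With `d = gcd(l-k, mn)`, `e = gcd(l-k, m)`, `r = d/e`,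
`Tr` the trace to `F_q`, `Tr_r` the trace to `F_{q^r}`, and `L'` the adjoint of `L`
(`L'(x) = (a·x)^(2^(-k)) + (b·x)^(2^(-l))`, inverse Frobenius powers realised by
`y ↦ y^(2^(mn - k mod mn))` etc.), the size of `ker Tr ∩ ker L'` is as described. -/
theorem stmt_1 (m n : ℕ) (hm : 0 < m) (hn : 0 < n)
    (F : Type*) [Field F] [Fintype F] (hF : Fintype.card F = 2 ^ (m * n))
    (a b : F) (k l : ℕ) (hab : ¬(a = 0 ∧ b = 0))
    (d e r : ℕ)
    (hd : d = Int.gcd ((l : ℤ) - (k : ℤ)) ((m : ℤ) * (n : ℤ)))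
    (he : e = Int.gcd ((l : ℤ) - (k : ℤ)) (m : ℤ))
    (hr : r = d / e)
    (Tr Trr L' : F → F)
    (hTr : ∀ x, Tr x = ∑ i ∈ Finset.range n, x ^ (2 ^ m) ^ i)
    (hTrr : ∀ x, Trr x = ∑ i ∈ Finset.range (n / r), x ^ ((2 ^ m) ^ r) ^ i)
    (hL' : ∀ x, L' x = (a * x) ^ 2 ^ (m * n - k % (m * n)) +
        (b * x) ^ 2 ^ (m * n - l % (m * n))) :
    (a ^ ((2 ^ (m * n) - 1) / (2 ^ d - 1)) ≠ b ^ ((2 ^ (m * n) - 1) / (2 ^ d - 1)) →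
        Nat.card {x : F // Tr x = 0 ∧ L' x = 0} = 1) ∧
    (a ^ ((2 ^ (m * n) - 1) / (2 ^ d - 1)) = b ^ ((2 ^ (m * n) - 1) / (2 ^ d - 1)) →
      ((k % m = l % m ∧ (a + b) ^ 2 ^ m = a + b →
          ((a + b ≠ 0 ∨ (a + b = 0 ∧ Trr a⁻¹ = 0) →
              Nat.card {x : F // Tr x = 0 ∧ L' x = 0} = 2 ^ d) ∧
           (a + b = 0 ∧ Trr a⁻¹ ≠ 0 →
              Nat.card {x : F // Tr x = 0 ∧ L' x = 0} = (2 ^ m) ^ (r - 1)))) ∧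
       (k % m ≠ l % m ∧ a ^ 2 ^ m = a ∧ b ^ 2 ^ m = b →
          ((a ^ ((2 ^ m - 1) / (2 ^ e - 1)) ≠ b ^ ((2 ^ m - 1) / (2 ^ e - 1)) ∨ Even (n / r) →
              Nat.card {x : F // Tr x = 0 ∧ L' x = 0} = 2 ^ d) ∧
           (a ^ ((2 ^ m - 1) / (2 ^ e - 1)) = b ^ ((2 ^ m - 1) / (2 ^ e - 1)) ∧ ¬ Even (n / r) →
              Nat.card {x : F // Tr x = 0 ∧ L' x = 0} = 2 ^ (d - e)))))) := by
  have hF' : Nat.card F = 2 ^ (m * n) := by rw [Nat.card_eq_fintype_card, hF]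
  have : CharP F 2 := charP_of_card_eq_prime_pow hF
  have hN : 0 < m * n := Nat.mul_pos hm hn
  have hq (x : F) : x ^ 2 ^ (m * n) = x := by rw [← hF, FiniteField.pow_card]
  set t := m * n - k % (m * n) + l % (m * n)
  replace hd : d = Nat.gcd t (m * n) := by
    rw [hd, ← Nat.cast_mul, Int.gcd_sub_eq_natGcd hN dvd_rfl]
  have he' : e = Nat.gcd t m := by rw [he, Int.gcd_sub_eq_natGcd hN (Dvd.intro _ rfl)]
  have key (x : F) :
      (Tr x = 0 ∧ L' x = 0) ↔ (trSum m n x = 0 ∧ (a * x) ^ 2 ^ t = b * x) := by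
    rw [hTr, hL', adjoint_eq_zero_iff hN hF', trSum]
  simp only [key]
  constructor
  · intro h
    have hzero (x : F) : (trSum m n x = 0 ∧ (a * x) ^ 2 ^ t = b * x) ↔ x = 0 := by
      refine ⟨fun ⟨_, hx⟩ => by_contra fun hx0 => ?_, fun hx => by simp [hx, trSum_zero]⟩
      rcases eq_or_ne a 0 with ha | ha
      · rw [ha, zero_mul, zero_pow (by positivity), eq_comm, mul_eq_zero] at hx
        exact hab ⟨ha, hx.resolve_right hx0⟩
      · exact h (hd ▸ pow_eq_pow_of_mem_ker ha hx0 (hq a) (hq x) hx)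
    simp only [hzero, Nat.card_unique]
  intro h
  have hE : (2 ^ (m * n) - 1) / (2 ^ d - 1) ≠ 0 := by
    have hd0 : 0 < d := hd ▸ Nat.gcd_pos_of_pos_right _ hN
    have hdN : d ≤ m * n := hd ▸ Nat.gcd_le_right _ hN
    have h1 : 1 < 2 ^ d := Nat.one_lt_two_pow hd0.ne'
    have h2 : 2 ^ d ≤ 2 ^ (m * n) := Nat.pow_le_pow_right two_pos hdN
    exact (Nat.div_pos (by omega) (by omega)).ne'
  have ha : a ≠ 0 := fun ha => hab ⟨ha, by
    rw [ha, zero_pow hE] at h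
    exact pow_eq_zero_iff hE |>.1 h.symm⟩
  have hb : b ≠ 0 := fun hb => ha (by
    rw [hb, zero_pow hE] at h
    exact pow_eq_zero_iff hE |>.1 h)
  obtain ⟨z, hz0, -, hz⟩ := exists_ker_ne_zero hF' dvd_rfl ha hb (hq a) (hd ▸ h)
  obtain ⟨hder, hrn, g, hg, hgr⟩ := gcd_div_facts hm hd he' hr
  refine ⟨fun ⟨hkl, hadd⟩ => ?_, fun ⟨_, ham, hbm⟩ => ?_⟩
  · have hem : e = m := by
      obtain ⟨c, hc⟩ := Nat.modEq_iff_dvd.1 hkl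
      simp [he, hc]
    have hmt : m ∣ t := hem ▸ he' ▸ Nat.gcd_dvd_left t m
    rw [hem] at hder
    have hTrr' (x : F) : Trr x = trSum (m * r) (n / r) x := by
      rw [hTrr, trSum, pow_mul]
    have hback {x : F} (hab0 : a + b = 0) (hx : (a * x) ^ 2 ^ t = b * x) :
        trSum m n x = trSum m r (trSum (m * r) (n / r) a⁻¹ * (a * x)) := by
      rw [← CharTwo.add_eq_zero.1 hab0, pow_two_pow_eq_self_iff hd hF', hder] at hx
      rw [← trSum_inv_mul hx, Nat.mul_div_cancel' hrn, inv_mul_cancel_left₀ ha]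
    refine ⟨fun hc => card_trSum_ker_of_forall hN hF' hd hb hz0 hz fun x hx => ?_,
      fun ⟨hab0, hw⟩ => ?_⟩
    · rcases hc with hab0 | ⟨hab0, hw⟩
      · exact trSum_eq_zero_of_add_fixed hmt hadd hab0 (hq _) hx
      · rw [hback hab0 hx, ← hTrr', hw, zero_mul, trSum_zero]
    · rw [← CharTwo.add_eq_zero.1 hab0, ← pow_mul]
      exact card_trSum_ker_eq hm hn hF' (hder ▸ hd) hrn ha (hTrr' _ ▸ hw)
  · have hodd (heq : a ^ ((2 ^ m - 1) / (2 ^ e - 1)) = b ^ ((2 ^ m - 1) / (2 ^ e - 1))) :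
        (Even (n / r) →
          Nat.card {x : F // trSum m n x = 0 ∧ (a * x) ^ 2 ^ t = b * x} = 2 ^ d) ∧
        (¬ Even (n / r) →
          Nat.card {x : F // trSum m n x = 0 ∧ (a * x) ^ 2 ^ t = b * x} =
            2 ^ (e * (r - 1))) := by
      obtain ⟨z, hz0, hzm, hz⟩ := exists_ker_ne_zero hF' (Dvd.intro _ rfl) ha hb ham (he' ▸ heq)
      have hcard := card_trSum_ker_of_mem_ker (hg ▸ hN) (hg ▸ hF') (by rw [← hder, ← hg, hd]) hrn hgr
        hb hz0 (hg ▸ hzm) hz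
      rwa [← hg, ← hder] at hcard
    refine ⟨fun hc => ?_, fun ⟨heq, hne⟩ => ?_⟩
    · by_cases heq : a ^ ((2 ^ m - 1) / (2 ^ e - 1)) = b ^ ((2 ^ m - 1) / (2 ^ e - 1))
      · exact (hodd heq).1 (hc.resolve_left (not_not.2 heq))
      · refine card_trSum_ker_of_forall hN hF' hd hb hz0 hz fun x hx => by_contra fun hx0 => ?_
        refine heq (he' ▸ pow_eq_pow_of_mem_ker ha hx0 ham (trSum_fixed (hq x)) ?_)
        rw [← trSum_mul_of_fixed ham, trSum_pow, hx, trSum_mul_of_fixed hbm]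
    · rw [(hodd heq).2 hne, hder, Nat.mul_sub, mul_one]
end

section
/- Let n be odd, L(x) = a·x^{2^k} + b·x^{2^l} be nonzero with a, b ∈ F_{q^n}, and k, l integers with 0 ≤ k, l < mn and k ≡ l (mod m). Set d = gcd(l-k, mn) and s = gcd(k-1, m). Then Tr(x^{q+1}) + L(x) is a permutation polynomial of F_{q^n} if and only if either (1) a + b ∈ F_q^*, (a+b)^{(q-1)/(2^s-1)} ≠ 1 and a^{(q^n-1)/(2^d-1)} ≠ b^{(q^n-1)/(2^d-1)}, or (2) a + b = 0, d = m and Tr(a^{-1}) ≠ 0. -/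
theorem IsCyclic.exists_pow_eq_mul_pow_iff {G : Type*} [CommGroup G] [IsCyclic G] [Finite G]
    (c : G) (i j : ℕ) :
    (∃ v : G, v ^ i = c * v ^ j) ↔
      c ^ (Nat.card G / Int.gcd ((i : ℤ) - j) (Nat.card G)) = 1 := by
  set N := Nat.card G with hN
  set D := Int.gcd ((i : ℤ) - j) N with hD
  have hDN : D ∣ N := Int.natCast_dvd_natCast.1 (Int.gcd_dvd_right ..)
  have hD0 : D * (N / D) = N := Nat.mul_div_cancel' hDN
  have key (v : G) : v ^ i = c * v ^ j ↔ c = v ^ ((i : ℤ) - j) := by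
    rw [zpow_sub, zpow_natCast, zpow_natCast, eq_mul_inv_iff_mul_eq, eq_comm]
  simp only [key]
  constructor
  · rintro ⟨v, rfl⟩
    obtain ⟨t, ht⟩ : (D : ℤ) ∣ (i : ℤ) - j := Int.gcd_dvd_left ..
    rw [ht, ← zpow_natCast, ← zpow_mul, mul_right_comm, ← Nat.cast_mul, hD0, zpow_mul,
      zpow_natCast, pow_card_eq_one', one_zpow]
  · intro hc
    have hle : (powMonoidHom D : G →* G).range ≤ (powMonoidHom (N / D) : G →* G).ker := by
      rintro _ ⟨v, rfl⟩
      rw [MonoidHom.mem_ker, powMonoidHom_apply, powMonoidHom_apply, ← pow_mul, hD0, hN,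
        pow_card_eq_one']
    have heq := Subgroup.eq_of_le_of_card_ge hle <| by
      rw [IsCyclic.card_powMonoidHom_range, IsCyclic.card_powMonoidHom_ker, ← hN,
        Nat.gcd_eq_right (Nat.div_dvd_of_dvd hDN), Nat.gcd_eq_right hDN]
    obtain ⟨w, hw⟩ : c ∈ (powMonoidHom D : G →* G).range := by
      rw [heq]; simpa [MonoidHom.mem_ker] using hc
    refine ⟨w ^ Int.gcdA ((i : ℤ) - j) N, ?_⟩
    rw [← hw, powMonoidHom_apply, ← zpow_natCast, hD, Int.gcd_eq_gcd_ab, zpow_add, zpow_mul w (N : ℤ),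
      zpow_natCast w N, hN, pow_card_eq_one', one_zpow, mul_one, ← zpow_mul, mul_comm]

theorem FiniteField.exists_pow_eq_mul_pow_iff {F : Type*} [Field F] [Fintype F] {M : ℕ}
    (hM : M ∣ Fintype.card F - 1) {c : F} (hc0 : c ≠ 0) (hc : c ^ M = 1) (i j : ℕ) :
    (∃ v : F, v ≠ 0 ∧ v ^ M = 1 ∧ v ^ i = c * v ^ j) ↔
      c ^ (M / Int.gcd ((i : ℤ) - j) M) = 1 := by
  have hcard : Nat.card (powMonoidHom M : Fˣ →* Fˣ).ker = M := by
    rw [IsCyclic.card_powMonoidHom_ker, Nat.card_units, Nat.card_eq_fintype_card,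
      Nat.gcd_eq_right hM]
  have hmem (u : Fˣ) : u ∈ (powMonoidHom M : Fˣ →* Fˣ).ker ↔ (u : F) ^ M = 1 := by
    rw [MonoidHom.mem_ker, powMonoidHom_apply, Units.ext_iff, Units.val_pow_eq_pow_val,
      Units.val_one]
  have h := IsCyclic.exists_pow_eq_mul_pow_iff
    (⟨Units.mk0 c hc0, (hmem _).2 hc⟩ : (powMonoidHom M : Fˣ →* Fˣ).ker) i j
  rw [hcard] at h
  simp only [Subtype.ext_iff, Subgroup.coe_pow, Subgroup.coe_mul, Units.ext_iff,
    Units.val_pow_eq_pow_val, Units.val_mul, Units.val_mk0, Subgroup.coe_one, Units.val_one] at h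
  rw [← h]
  constructor
  · rintro ⟨v, hv0, hv, hvc⟩
    exact ⟨⟨Units.mk0 v hv0, (hmem _).2 hv⟩, hvc⟩
  · rintro ⟨v, hvc⟩
    exact ⟨(v : Fˣ), (v : Fˣ).ne_zero, (hmem _).1 v.2, hvc⟩

theorem FiniteField.le_of_forall_pow_eq_self {F : Type*} [Field F] [Fintype F] {M N : ℕ}
    (hN : 0 < N) (hM : M ∣ Fintype.card F - 1) (h : ∀ x : F, x ^ M = 1 → x ^ N = 1) : M ≤ N := by
  have hcard : Nat.card (powMonoidHom M : Fˣ →* Fˣ).ker = M := by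
    rw [IsCyclic.card_powMonoidHom_ker, Nat.card_units, Nat.card_eq_fintype_card,
      Nat.gcd_eq_right hM]
  rw [← hcard]
  refine (Subgroup.card_le_of_le (K := (powMonoidHom N : Fˣ →* Fˣ).ker) fun u hu => ?_).trans ?_
  · simp only [MonoidHom.mem_ker, powMonoidHom_apply, Units.ext_iff, Units.val_pow_eq_pow_val,
      Units.val_one] at hu ⊢
    exact h u hu
  · rw [IsCyclic.card_powMonoidHom_ker]
    exact Nat.gcd_le_right _ hN

theorem Int.gcd_two_pow_sub_two_pow {i j N : ℕ} (hN : 0 < N) :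
    Int.gcd (((2 ^ i : ℕ) : ℤ) - (2 ^ j : ℕ)) ((2 ^ N - 1 : ℕ) : ℤ) =
      2 ^ Int.gcd ((i : ℤ) - j) N - 1 := by
  wlog hij : j ≤ i generalizing i j
  · rw [← Int.neg_gcd, neg_sub, this (le_of_not_ge hij), ← Int.neg_gcd, neg_sub]
  obtain ⟨t, rfl⟩ := Nat.exists_eq_add_of_le hij
  have h1 : ((2 ^ (j + t) : ℕ) : ℤ) - (2 ^ j : ℕ) = ((2 ^ j * (2 ^ t - 1) : ℕ) : ℤ) := by
    push_cast [Nat.one_le_two_pow]; ring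
  have h2 : ((j + t : ℕ) : ℤ) - j = (t : ℤ) := by push_cast; ring
  have hodd : Nat.Coprime (2 ^ j) (2 ^ N - 1) := by
    refine Nat.Coprime.pow_left _ (Nat.coprime_two_left.2 ?_)
    exact Nat.Even.sub_odd Nat.one_le_two_pow (Nat.even_pow.2 ⟨even_two, hN.ne'⟩) odd_one
  rw [h1, h2, Int.gcd_natCast_natCast, Int.gcd_natCast_natCast, hodd.gcd_mul_left_cancel,
    Nat.pow_sub_one_gcd_pow_sub_one]

theorem pow_two_pow_mul_eq_self_s2 {M : Type*} [Monoid M] {m : ℕ} {c : M} (hc : c ^ 2 ^ m = c)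
    (i : ℕ) : c ^ (2 ^ m) ^ i = c := by
  induction i with
  | zero => simp
  | succ i ih => rw [pow_succ, pow_mul, ih, hc]

theorem pow_two_pow_eq_of_mod_eq {M : Type*} [Monoid M] {m : ℕ} {c : M} (hc : c ^ 2 ^ m = c)
    {k l : ℕ} (hkl : k % m = l % m) : c ^ 2 ^ k = c ^ 2 ^ l := by
  have key (j : ℕ) : c ^ 2 ^ j = c ^ 2 ^ (j % m) := by
    conv_lhs => rw [← Nat.div_add_mod j m]
    rw [pow_add, pow_mul, pow_mul, pow_two_pow_mul_eq_self_s2 hc]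
  rw [key k, key l, hkl]

theorem pow_two_pow_gcd_eq_self_s2 {M : Type*} [Monoid M] {N k l : ℕ}
    (hinj : Function.Injective fun x : M => x ^ 2 ^ k) {c : M} (hc : c ^ 2 ^ N = c) (hkl : k ≤ l)
    (h : c ^ 2 ^ k = c ^ 2 ^ l) : c ^ 2 ^ Nat.gcd (l - k) N = c := by
  obtain ⟨t, rfl⟩ := Nat.exists_eq_add_of_le hkl
  have ht : c ^ 2 ^ t = c := by
    refine hinj ?_
    simp only [h]
    rw [← pow_mul, ← pow_add, add_comm]
  have hper (i : ℕ) : Function.IsPeriodicPt (fun x : M => x ^ 2) i c ↔ c ^ 2 ^ i = c := by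
    rw [Function.IsPeriodicPt, Function.IsFixedPt, pow_iterate]
  rw [Nat.add_sub_cancel_left]
  exact (hper _).1 (((hper t).2 ht).gcd ((hper N).2 hc))

theorem pow_eq_self_iff_pow_sub_one_eq_one {F : Type*} [Field F] {v : F} (hv : v ≠ 0) (j : ℕ) :
    v ^ 2 ^ j = v ↔ v ^ (2 ^ j - 1) = 1 := by
  have h : v ^ 2 ^ j = v ^ (2 ^ j - 1) * v := by
    rw [← pow_succ, Nat.sub_add_cancel Nat.one_le_two_pow]
  rw [h, mul_eq_right₀ hv]

theorem forall_sq_ne_mul_pow_iff {F : Type*} [Field F] [Fintype F]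
    {m n : ℕ} (hm : 0 < m) (hF : Fintype.card F = 2 ^ (m * n))
    {c : F} (hc0 : c ≠ 0) (hc : c ^ 2 ^ m = c) (k : ℕ) :
    (∀ v : F, v ≠ 0 → v ^ 2 ^ m = v → v ^ 2 ≠ c * v ^ 2 ^ k) ↔
      c ^ ((2 ^ m - 1) / (2 ^ Int.gcd ((k : ℤ) - 1) m - 1)) ≠ 1 := by
  have hgcd : Int.gcd (((2 ^ 1 : ℕ) : ℤ) - (2 ^ k : ℕ)) ((2 ^ m - 1 : ℕ) : ℤ) =
      2 ^ Int.gcd ((k : ℤ) - 1) m - 1 := by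
    rw [Int.gcd_two_pow_sub_two_pow hm, ← Int.neg_gcd, neg_sub, Nat.cast_one]
  have key := FiniteField.exists_pow_eq_mul_pow_iff
    (by rw [hF]; exact Nat.pow_sub_one_dvd_pow_sub_one 2 (dvd_mul_right m n)) hc0
    ((pow_eq_self_iff_pow_sub_one_eq_one hc0 _).1 hc) (2 ^ 1) (2 ^ k)
  rw [hgcd, pow_one] at key
  rw [ne_eq, ← key]
  push Not
  exact forall₂_congr fun v hv => by rw [pow_eq_self_iff_pow_sub_one_eq_one hv]

theorem eq_of_forall_pow_two_pow_eq_self {F : Type*} [Field F] [Fintype F]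
    {m n : ℕ} (hm : 0 < m) (hn : Odd n)
    (hF : Fintype.card F = 2 ^ (m * n)) {d : ℕ} (hmd : m ∣ d) (hd : d ∣ m * n)
    (h : ∀ x : F, x ^ 2 ^ d = x → x ^ 2 ^ m = x) : d = m := by
  have hd0 : d ≠ 0 := (Nat.pos_of_dvd_of_pos hd (Nat.mul_pos hm hn.pos)).ne'
  have hle := FiniteField.le_of_forall_pow_eq_self (F := F) (M := 2 ^ d - 1) (N := 2 ^ m - 1)
    (Nat.sub_pos_of_lt (Nat.one_lt_two_pow hm.ne'))
    (by rw [hF]; exact Nat.pow_sub_one_dvd_pow_sub_one 2 hd) fun x hx => by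
      have hx0 : x ≠ 0 := by
        rintro rfl
        rw [zero_pow (Nat.sub_pos_of_lt (Nat.one_lt_two_pow hd0)).ne'] at hx
        exact zero_ne_one hx
      exact (pow_eq_self_iff_pow_sub_one_eq_one hx0 m).1
        (h x ((pow_eq_self_iff_pow_sub_one_eq_one hx0 d).2 hx))
  have : 2 ^ d ≤ 2 ^ m := by
    have := Nat.one_le_two_pow (n := m)
    omega
  exact le_antisymm ((Nat.pow_le_pow_iff_right one_lt_two).1 this)
    (Nat.le_of_dvd (Nat.pos_of_ne_zero hd0) hmd)

section CharTwo

variable {F : Type*} [Field F] [CharP F 2]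

theorem CharTwo.add_pow_two_pow (x y : F) (k : ℕ) :
    (x + y) ^ 2 ^ k = x ^ 2 ^ k + y ^ 2 ^ k :=
  map_add (iterateFrobenius F 2 k) x y

theorem CharTwo.pow_two_pow_injective (k : ℕ) : Function.Injective fun x : F => x ^ 2 ^ k :=
  (iterateFrobenius F 2 k).injective

variable (F) in
/-- The map `x ↦ ∑ i < n, x ^ (2 ^ m) ^ i`, which is the trace onto the subfield with `2 ^ m`
elements when `F` has `2 ^ (m * n)` elements. -/
noncomputable def frobeniusTrace (m n : ℕ) : F →+ F :=
  ∑ i ∈ Finset.range n, (iterateFrobenius F 2 (m * i)).toAddMonoidHom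

variable {m n : ℕ}

theorem frobeniusTrace_apply (x : F) :
    frobeniusTrace F m n x = ∑ i ∈ Finset.range n, x ^ (2 ^ m) ^ i := by
  simp [frobeniusTrace, AddMonoidHom.finsetSum_apply, iterateFrobenius_def, pow_mul]

theorem frobeniusTrace_mul {c : F} (hc : c ^ 2 ^ m = c) (x : F) :
    frobeniusTrace F m n (c * x) = c * frobeniusTrace F m n x := by
  simp only [frobeniusTrace_apply, mul_pow, pow_two_pow_mul_eq_self_s2 hc, Finset.mul_sum]

theorem frobeniusTrace_of_odd (hn : Odd n) {c : F} (hc : c ^ 2 ^ m = c) :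
    frobeniusTrace F m n c = c := by
  have h2 : (n : F) = 1 := by
    obtain ⟨t, rfl⟩ := hn
    simp [CharTwo.two_eq_zero]
  simp [frobeniusTrace_apply, pow_two_pow_mul_eq_self_s2 hc, h2]

theorem frobeniusTrace_pow_two_pow (x : F) (k : ℕ) :
    frobeniusTrace F m n (x ^ 2 ^ k) = frobeniusTrace F m n x ^ 2 ^ k := by
  simp only [frobeniusTrace_apply, ← iterateFrobenius_def 2 k, map_sum, map_pow]

/-- The linearized binomial `a x ^ (2 ^ k) + b x ^ (2 ^ l)`. -/
noncomputable def frobeniusBinomial (a b : F) (k l : ℕ) : F →+ F :=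
  (AddMonoidHom.mulLeft a).comp (iterateFrobenius F 2 k).toAddMonoidHom +
    (AddMonoidHom.mulLeft b).comp (iterateFrobenius F 2 l).toAddMonoidHom

theorem frobeniusBinomial_apply (a b : F) (k l : ℕ) (x : F) :
    frobeniusBinomial a b k l x = a * x ^ 2 ^ k + b * x ^ 2 ^ l := rfl

theorem frobeniusBinomial_apply_of_pow_eq_self (a b : F) {k l : ℕ} (hkl : k % m = l % m) {x : F}
    (hx : x ^ 2 ^ m = x) : frobeniusBinomial a b k l x = (a + b) * x ^ 2 ^ k := by
  rw [frobeniusBinomial_apply, ← pow_two_pow_eq_of_mod_eq hx hkl, add_mul]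

variable [Fintype F]

theorem frobeniusTrace_pow_eq_self (hF : Fintype.card F = 2 ^ (m * n)) (x : F) :
    frobeniusTrace F m n x ^ 2 ^ m = frobeniusTrace F m n x := by
  rw [← frobeniusTrace_pow_two_pow, frobeniusTrace_apply, frobeniusTrace_apply,
    ← sub_eq_zero, ← Finset.sum_sub_distrib]
  have h (i : ℕ) : (x ^ 2 ^ m) ^ (2 ^ m) ^ i = x ^ (2 ^ m) ^ (i + 1) := by
    rw [← pow_mul, pow_succ']
  simp only [h]
  rw [Finset.sum_range_sub (fun i => x ^ (2 ^ m) ^ i), ← pow_mul, ← hF, FiniteField.pow_card,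
    pow_zero, pow_one, sub_self]

theorem frobeniusTrace_pow_two_pow_self (hF : Fintype.card F = 2 ^ (m * n)) (x : F) :
    frobeniusTrace F m n (x ^ 2 ^ m) = frobeniusTrace F m n x := by
  rw [frobeniusTrace_pow_two_pow, frobeniusTrace_pow_eq_self hF]

theorem exists_frobeniusTrace_eq (hF : Fintype.card F = 2 ^ (m * n)) (hn : Odd n) {v c : F}
    (hv : v ^ 2 ^ m ≠ v) (hc : c ^ 2 ^ m = c) :
    ∃ x, frobeniusTrace F m n (x ^ 2 ^ m * v + x * v ^ 2 ^ m) = c := by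
  obtain ⟨t, rfl⟩ := hn
  have hcard (y : F) : (y ^ (2 ^ m) ^ (2 * t)) ^ 2 ^ m = y := by
    rw [← pow_mul, ← pow_succ, ← pow_mul, ← hF, FiniteField.pow_card]
  have hw : v ^ (2 ^ m) ^ (2 * t) + v ^ 2 ^ m ≠ 0 := by
    rw [← CharTwo.sub_eq_add, sub_ne_zero]
    intro h
    have h2 : v ^ 2 ^ (m * 2) = v := by
      conv_rhs => rw [← hcard v, h]
      rw [← pow_mul, pow_mul 2, pow_two]
    refine hv ?_
    conv_rhs => rw [← hcard v, pow_mul (2 ^ m) 2 t, ← pow_mul 2 m 2, pow_two_pow_mul_eq_self_s2 h2]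
  refine ⟨c / (v ^ (2 ^ m) ^ (2 * t) + v ^ 2 ^ m), ?_⟩
  set x := c / (v ^ (2 ^ m) ^ (2 * t) + v ^ 2 ^ m) with hx
  have : x ^ 2 ^ m * v = (x * v ^ (2 ^ m) ^ (2 * t)) ^ 2 ^ m := by rw [mul_pow, hcard]
  rw [this, map_add, frobeniusTrace_pow_two_pow_self hF, ← map_add, ← mul_add, hx,
    div_mul_cancel₀ _ hw, frobeniusTrace_of_odd ⟨t, rfl⟩ hc]

/-- `Tr(x^(q+1)) + L(x)` permutes `F` iff it has no nonzero root in the field of `q` elements and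
`L` takes values in that field only on it. -/
theorem bijective_frobeniusTrace_add_iff (hF : Fintype.card F = 2 ^ (m * n)) (hn : Odd n)
    (L : F →+ F) :
    Function.Bijective (fun x : F => frobeniusTrace F m n (x ^ (2 ^ m + 1)) + L x) ↔
      (∀ v : F, v ≠ 0 → v ^ 2 ^ m = v → v ^ 2 ≠ L v) ∧
        ∀ v : F, L v ^ 2 ^ m = L v → v ^ 2 ^ m = v := by
  have hadd (x v : F) : frobeniusTrace F m n ((x + v) ^ (2 ^ m + 1)) + L (x + v) =
      frobeniusTrace F m n (x ^ (2 ^ m + 1)) + L x +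
        (frobeniusTrace F m n (x ^ 2 ^ m * v + x * v ^ 2 ^ m) +
          (frobeniusTrace F m n (v ^ (2 ^ m + 1)) + L v)) := by
    have : (x + v) ^ (2 ^ m + 1) =
        x ^ (2 ^ m + 1) + (x ^ 2 ^ m * v + x * v ^ 2 ^ m) + v ^ (2 ^ m + 1) := by
      rw [pow_succ, CharTwo.add_pow_two_pow]; ring
    rw [this]
    simp only [map_add]
    ring
  have hself {v : F} (hv : v ^ 2 ^ m = v) : frobeniusTrace F m n (v ^ (2 ^ m + 1)) = v ^ 2 := by
    rw [pow_succ, hv, ← pow_two, frobeniusTrace_of_odd hn]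
    rw [← pow_mul, mul_comm, pow_mul, hv]
  rw [← Finite.injective_iff_bijective]
  constructor
  · refine fun hinj => ⟨fun v hv0 hv h => hv0 (hinj ?_), fun v hLv => ?_⟩
    · simp [hself hv, h, CharTwo.add_self_eq_zero]
    · by_contra hv
      obtain ⟨x, hx⟩ := exists_frobeniusTrace_eq (m := m) (n := n)
        (c := frobeniusTrace F m n (v ^ (2 ^ m + 1)) + L v) hF hn hv
        (by rw [CharTwo.add_pow_two_pow, frobeniusTrace_pow_eq_self hF, hLv])
      have : x + v = x := hinj <| by
        simp only [hadd x v, hx, CharTwo.add_self_eq_zero, add_zero]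
      rw [add_eq_left] at this
      exact hv (by simp [this])
  · rintro ⟨h0, hL⟩ x y hxy
    obtain ⟨v, rfl⟩ : ∃ v, y = x + v := ⟨y - x, by ring⟩
    simp only [hadd x v, left_eq_add] at hxy
    have hv : v ^ 2 ^ m = v := hL v <| by
      rw [← add_assoc, ← map_add, add_comm, CharTwo.add_eq_zero] at hxy
      rw [hxy, frobeniusTrace_pow_eq_self hF]
    rw [hv, map_add, mul_comm _ v, mul_comm _ v, frobeniusTrace_mul hv, frobeniusTrace_mul hv,
      frobeniusTrace_pow_two_pow_self hF, CharTwo.add_self_eq_zero, zero_add, hself hv,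
      CharTwo.add_eq_zero] at hxy
    by_contra hne
    exact h0 v (fun h => hne (by simp [h])) hv hxy

theorem pow_two_pow_eq_iff (hF : Fintype.card F = 2 ^ (m * n)) (x : F) (k l : ℕ) :
    x ^ 2 ^ k = x ^ 2 ^ l ↔ x ^ 2 ^ Int.gcd ((l : ℤ) - k) ((m : ℤ) * n) = x := by
  have hx : x ^ 2 ^ (m * n) = x := by rw [← hF, FiniteField.pow_card]
  constructor
  · wlog hkl : k ≤ l generalizing k l
    · intro h
      rw [← Int.neg_gcd, neg_sub]
      exact this l k (le_of_not_ge hkl) h.symm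
    · intro h
      rw [← Nat.cast_sub hkl, ← Nat.cast_mul, Int.gcd_natCast_natCast]
      exact pow_two_pow_gcd_eq_self_s2 (CharTwo.pow_two_pow_injective k) hx hkl h
  · exact fun h => pow_two_pow_eq_of_mod_eq h
      ((Nat.modEq_iff_dvd).2 (Int.gcd_dvd_left ..))

theorem range_frobeniusBinomial_one_one (hF : Fintype.card F = 2 ^ (m * n)) (hn : Odd n)
    {k l : ℕ} (hkl : k % m = l % m) (hd : Int.gcd ((l : ℤ) - k) ((m : ℤ) * n) = m) :
    (frobeniusBinomial (1 : F) 1 k l).range = (frobeniusTrace F m n).ker := by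
  have hle : (frobeniusBinomial (1 : F) 1 k l).range ≤ (frobeniusTrace F m n).ker := by
    rintro _ ⟨x, rfl⟩
    rw [AddMonoidHom.mem_ker, frobeniusBinomial_apply, one_mul, one_mul, map_add,
      frobeniusTrace_pow_two_pow, frobeniusTrace_pow_two_pow,
      pow_two_pow_eq_of_mod_eq (frobeniusTrace_pow_eq_self hF x) hkl, CharTwo.add_self_eq_zero]
  have heq : (frobeniusBinomial (1 : F) 1 k l).ker = (frobeniusTrace F m n).range := by
    ext x
    rw [AddMonoidHom.mem_ker, frobeniusBinomial_apply, one_mul, one_mul, CharTwo.add_eq_zero,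
      pow_two_pow_eq_iff hF, hd]
    constructor
    · exact fun hx => ⟨x, frobeniusTrace_of_odd hn hx⟩
    · rintro ⟨y, rfl⟩
      exact frobeniusTrace_pow_eq_self hF y
  refine AddSubgroup.eq_of_le_of_card_ge hle (Eq.le ?_)
  have h1 := (frobeniusBinomial (1 : F) 1 k l).ker.card_mul_index
  have h2 := (frobeniusTrace F m n).ker.card_mul_index
  rw [AddSubgroup.index_ker, heq] at h1
  rw [AddSubgroup.index_ker, mul_comm, ← h1] at h2
  exact Nat.eq_of_mul_eq_mul_left Nat.card_pos h2

theorem forall_frobeniusBinomial_self_iff (hF : Fintype.card F = 2 ^ (m * n)) (hn : Odd n)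
    {a : F} (ha : a ≠ 0) {k l : ℕ} (hkl : k % m = l % m)
    (hd : Int.gcd ((l : ℤ) - k) ((m : ℤ) * n) = m) :
    (∀ v : F, frobeniusBinomial a a k l v ^ 2 ^ m = frobeniusBinomial a a k l v →
      v ^ 2 ^ m = v) ↔ frobeniusTrace F m n a⁻¹ ≠ 0 := by
  have hL (v : F) : frobeniusBinomial a a k l v = a * frobeniusBinomial 1 1 k l v := by
    simp only [frobeniusBinomial_apply]; ring
  have hrange := range_frobeniusBinomial_one_one hF hn hkl hd
  constructor
  · intro h h0
    obtain ⟨v, hv⟩ : a⁻¹ ∈ (frobeniusBinomial (1 : F) 1 k l).range := by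
      rw [hrange]; exact h0
    have hv1 := hL v
    rw [hv, mul_inv_cancel₀ ha] at hv1
    have hvK := h v (by rw [hv1, one_pow])
    rw [frobeniusBinomial_apply_of_pow_eq_self a a hkl hvK, CharTwo.add_self_eq_zero,
      zero_mul] at hv1
    exact zero_ne_one hv1
  · intro h v hv
    have hmem : frobeniusBinomial 1 1 k l v ∈ (frobeniusTrace F m n).ker := by
      rw [← hrange]; exact ⟨v, rfl⟩
    have h1 : frobeniusBinomial 1 1 k l v = frobeniusBinomial a a k l v * a⁻¹ := by
      rw [hL, mul_comm a, mul_inv_cancel_right₀ ha]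
    rw [AddMonoidHom.mem_ker, h1, frobeniusTrace_mul hv, mul_eq_zero, or_iff_left h] at hmem
    rw [hmem, zero_mul, frobeniusBinomial_apply, one_mul, one_mul, CharTwo.add_eq_zero,
      pow_two_pow_eq_iff hF, hd] at h1
    exact h1

theorem frobeniusBinomial_injective_iff (hm : 0 < m) (hn : Odd n)
    (hF : Fintype.card F = 2 ^ (m * n)) {a b : F} (hab : ¬(a = 0 ∧ b = 0)) (k l : ℕ) :
    (∀ v : F, frobeniusBinomial a b k l v = 0 → v = 0) ↔
      a ^ ((2 ^ (m * n) - 1) / (2 ^ Int.gcd ((l : ℤ) - k) ((m : ℤ) * n) - 1)) ≠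
        b ^ ((2 ^ (m * n) - 1) / (2 ^ Int.gcd ((l : ℤ) - k) ((m : ℤ) * n) - 1)) := by
  have hmn : 0 < m * n := Nat.mul_pos hm hn.pos
  set d := Int.gcd ((l : ℤ) - k) ((m : ℤ) * n) with hd
  have hdvd : d ∣ m * n := by
    rw [hd, ← Nat.cast_mul]
    exact Int.natCast_dvd_natCast.1 (Int.gcd_dvd_right ..)
  have hpos : (2 ^ (m * n) - 1) / (2 ^ d - 1) ≠ 0 := by
    have h1 : 0 < 2 ^ (m * n) - 1 := Nat.sub_pos_of_lt (Nat.one_lt_two_pow hmn.ne')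
    exact (Nat.div_pos (Nat.le_of_dvd h1 (Nat.pow_sub_one_dvd_pow_sub_one 2 hdvd))
      (Nat.sub_pos_of_lt (Nat.one_lt_two_pow (Nat.pos_of_dvd_of_pos hdvd hmn).ne'))).ne'
  by_cases hb : b = 0
  · have ha : a ≠ 0 := fun h => hab ⟨h, hb⟩
    simp [frobeniusBinomial_apply, hb, ha, hpos]
  by_cases ha : a = 0
  · simp [frobeniusBinomial_apply, hb, ha, hpos, (pow_ne_zero _ hb).symm]
  have hone {c : F} (hc : c ≠ 0) : c ^ (2 ^ (m * n) - 1) = 1 := by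
    rw [← hF, FiniteField.pow_card_sub_one_eq_one c hc]
  have hgcd : Int.gcd (((2 ^ l : ℕ) : ℤ) - (2 ^ k : ℕ)) ((2 ^ (m * n) - 1 : ℕ) : ℤ) =
      2 ^ d - 1 := by
    rw [Int.gcd_two_pow_sub_two_pow hmn, hd, Nat.cast_mul]
  have key := FiniteField.exists_pow_eq_mul_pow_iff (by rw [hF]) (div_ne_zero ha hb)
    (hone (div_ne_zero ha hb)) (2 ^ l) (2 ^ k)
  rw [hgcd, div_pow, div_eq_one_iff_eq (pow_ne_zero _ hb)] at key
  rw [ne_eq, ← key]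
  push Not
  refine forall_congr' fun v => ?_
  rw [frobeniusBinomial_apply, CharTwo.add_eq_zero, div_mul_eq_mul_div]
  simp only [ne_eq, eq_div_iff hb]
  rw [mul_comm b, eq_comm (b := v ^ 2 ^ l * b)]
  constructor
  · exact fun h hv _ h' => hv (h h')
  · exact fun h h' => by_contra fun hv => h hv (hone hv) h'

/-- If `L` maps only the subfield with `2 ^ m` elements into that subfield, then `L 1` lies in it,
provided `L` has no nonzero root there. -/
theorem pow_eq_self_of_forall_frobeniusBinomial {a b : F} {k l : ℕ} (hkl : k % m = l % m)
    (hab : a + b ≠ 0)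
    (h : ∀ v : F, frobeniusBinomial a b k l v ^ 2 ^ m = frobeniusBinomial a b k l v →
      v ^ 2 ^ m = v) : (a + b) ^ 2 ^ m = a + b := by
  have hinj : Function.Injective (frobeniusBinomial a b k l) := by
    refine (injective_iff_map_eq_zero _).2 fun v hv => ?_
    have hvK := h v (by rw [hv, zero_pow (by positivity)])
    rw [frobeniusBinomial_apply_of_pow_eq_self a b hkl hvK, mul_eq_zero, or_iff_right hab] at hv
    exact eq_zero_of_pow_eq_zero hv
  obtain ⟨v, hv⟩ := Finite.injective_iff_surjective.1 hinj 1
  have hvK := h v (by rw [hv, one_pow])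
  rw [frobeniusBinomial_apply_of_pow_eq_self a b hkl hvK] at hv
  have hc : a + b = (v ^ 2 ^ k)⁻¹ := eq_inv_of_mul_eq_one_left hv
  rw [hc, inv_pow, ← pow_mul, mul_comm, pow_mul, hvK]

theorem forall_frobeniusBinomial_iff_injective {a b : F} {k l : ℕ}
    (hkl : k % m = l % m) (hab0 : a + b ≠ 0) (hab : (a + b) ^ 2 ^ m = a + b) :
    (∀ v : F, frobeniusBinomial a b k l v ^ 2 ^ m = frobeniusBinomial a b k l v →
      v ^ 2 ^ m = v) ↔ ∀ v : F, frobeniusBinomial a b k l v = 0 → v = 0 := by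
  constructor
  · intro h v hv
    have hvK := h v (by rw [hv, zero_pow (by positivity)])
    rw [frobeniusBinomial_apply_of_pow_eq_self a b hkl hvK, mul_eq_zero, or_iff_right hab0] at hv
    exact eq_zero_of_pow_eq_zero hv
  · intro h v hv
    set w := frobeniusBinomial a b k l v with hw
    obtain ⟨u, hu⟩ := Finite.injective_iff_surjective.1
      (CharTwo.pow_two_pow_injective (F := F) k) (w / (a + b))
    simp only at hu
    have huK : u ^ 2 ^ m = u := CharTwo.pow_two_pow_injective k <| by
      simp only
      rw [← pow_mul, mul_comm, pow_mul, hu, div_pow, hv, hab]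
    have huw : frobeniusBinomial a b k l u = w := by
      rw [frobeniusBinomial_apply_of_pow_eq_self a b hkl huK, hu, mul_div_cancel₀ _ hab0]
    have hvu : v = u := (injective_iff_map_eq_zero _).2 h (hw.symm.trans huw.symm)
    rw [hvu, huK]

end CharTwo

/-- Let `n` be odd, `q = 2^m`, `F` the field with `q^n` elements,
`L(x) = a·x^(2^k) + b·x^(2^l)` nonzero with `0 ≤ k, l < mn` and `k ≡ l (mod m)`.
With `d = gcd(l-k, mn)` and `s = gcd(k-1, m)`, `Tr(x^(q+1)) + L(x)` is a permutation polynomial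
of `F` iff either (1) `a+b ∈ F_q^*`, `(a+b)^((q-1)/(2^s-1)) ≠ 1` and
`a^((q^n-1)/(2^d-1)) ≠ b^((q^n-1)/(2^d-1))`, or (2) `a+b = 0`, `d = m` and `Tr(a⁻¹) ≠ 0`. -/
theorem stmt_2 (m n : ℕ) (hm : 0 < m) (hn : Odd n)
    (F : Type*) [Field F] [Fintype F] (hF : Fintype.card F = 2 ^ (m * n))
    (a b : F) (k l : ℕ) (hk : k < m * n) (hl : l < m * n)
    (hab : ¬(a = 0 ∧ b = 0)) (hkl : k % m = l % m)
    (d s : ℕ)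
    (hd : d = Int.gcd ((l : ℤ) - (k : ℤ)) ((m : ℤ) * (n : ℤ)))
    (hs : s = Int.gcd ((k : ℤ) - 1) (m : ℤ))
    (Tr : F → F)
    (hTr : ∀ x, Tr x = ∑ i ∈ Finset.range n, x ^ (2 ^ m) ^ i) :
    Function.Bijective (fun x : F => Tr (x ^ (2 ^ m + 1)) + (a * x ^ 2 ^ k + b * x ^ 2 ^ l)) ↔
      ((a + b ≠ 0 ∧ (a + b) ^ 2 ^ m = a + b ∧
          (a + b) ^ ((2 ^ m - 1) / (2 ^ s - 1)) ≠ 1 ∧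
          a ^ ((2 ^ (m * n) - 1) / (2 ^ d - 1)) ≠ b ^ ((2 ^ (m * n) - 1) / (2 ^ d - 1))) ∨
       (a + b = 0 ∧ d = m ∧ Tr a⁻¹ ≠ 0)) := by
  have hmn : m * n ≠ 0 := (Nat.mul_pos hm hn.pos).ne'
  have : CharP F 2 := charP_of_card_eq_prime_pow hF
  have hTr' : Tr = frobeniusTrace F m n := funext fun x => by
    rw [hTr, frobeniusTrace_apply]
  simp only [hTr', ← frobeniusBinomial_apply]
  rw [bijective_frobeniusTrace_add_iff hF hn]
  by_cases hab0 : a + b = 0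
  · obtain rfl : a = b := CharTwo.add_eq_zero.1 hab0
    have ha : a ≠ 0 := fun h => hab ⟨h, h⟩
    simp only [hab0, ne_eq, not_true_eq_false, false_and, true_and, false_or]
    have h1 (v : F) (hv0 : v ≠ 0) (hv : v ^ 2 ^ m = v) :
        ¬ v ^ 2 = frobeniusBinomial a a k l v := by
      rw [frobeniusBinomial_apply_of_pow_eq_self a a hkl hv, hab0, zero_mul]
      exact pow_ne_zero 2 hv0
    rw [and_iff_right h1]
    suffices h : (∀ v : F, frobeniusBinomial a a k l v ^ 2 ^ m = frobeniusBinomial a a k l v →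
        v ^ 2 ^ m = v) → d = m by
      constructor
      · intro hL
        have hdm := h hL
        exact ⟨hdm, (forall_frobeniusBinomial_self_iff hF hn ha hkl (hd ▸ hdm)).1 hL⟩
      · rintro ⟨hdm, hT⟩
        exact (forall_frobeniusBinomial_self_iff hF hn ha hkl (hd ▸ hdm)).2 hT
    intro hL
    refine eq_of_forall_pow_two_pow_eq_self hm hn hF ?_ ?_ fun x hx => hL x ?_
    · rw [hd]
      exact Int.natCast_dvd_natCast.1 (Int.dvd_coe_gcd (Nat.modEq_iff_dvd.1 hkl) ⟨n, rfl⟩)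
    · rw [hd, ← Nat.cast_mul]
      exact Int.natCast_dvd_natCast.1 (Int.gcd_dvd_right ..)
    · rw [hd, ← pow_two_pow_eq_iff hF] at hx
      rw [frobeniusBinomial_apply, hx, CharTwo.add_self_eq_zero, zero_pow (by positivity)]
  · simp only [hab0, ne_eq, not_false_eq_true, false_and, true_and, or_false]
    suffices h : (a + b) ^ 2 ^ m = a + b →
        ((∀ v : F, v ≠ 0 → v ^ 2 ^ m = v → ¬ v ^ 2 = frobeniusBinomial a b k l v) ↔
          ¬ (a + b) ^ ((2 ^ m - 1) / (2 ^ s - 1)) = 1) by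
      constructor
      · rintro ⟨h1, h2⟩
        have hK := pow_eq_self_of_forall_frobeniusBinomial hkl hab0 h2
        exact ⟨hK, (h hK).1 h1, hd ▸ (frobeniusBinomial_injective_iff hm hn hF hab k l).1
          ((forall_frobeniusBinomial_iff_injective hkl hab0 hK).1 h2)⟩
      · rintro ⟨hK, h1, h2⟩
        exact ⟨(h hK).2 h1, (forall_frobeniusBinomial_iff_injective hkl hab0 hK).2
          ((frobeniusBinomial_injective_iff hm hn hF hab k l).2 (hd ▸ h2))⟩
    intro hK
    rw [hs, ← ne_eq, ← forall_sq_ne_mul_pow_iff hm hF hab0 hK k]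
    exact forall₃_congr fun v _ hv => by rw [frobeniusBinomial_apply_of_pow_eq_self a b hkl hv]
end

section
/- Let n = 3 and L(x) = a·x + b·x^q + c·x^{q^2} be a polynomial over F_{q^3} with L(1) = a + b + c = 0. Then |ker Tr ∩ ker L'| equals: 1 if Tr(a^{q+1} + a^q·b + b^{q+1}) ≠ 0; q^2 if a + b^{q^2} = 0 and a + c^q = 0; and q otherwise. -/
open Polynomial in
lemma natCard_le_of_forall_eval_eq_zero {F : Type*} [Field F] {d : ℕ} {P : F → Prop}
    (p : F[X]) (hp : p ≠ 0) (hd : p.natDegree ≤ d) (h : ∀ x, P x → p.eval x = 0) :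
    Nat.card {x : F // P x} ≤ d := by
  classical
  have hsub : {x : F | P x} ⊆ (p.roots.toFinset : Set F) := fun x hx => by
    simpa [hp] using h x hx
  calc Nat.card {x : F // P x} = Set.ncard {x : F | P x} := rfl
    _ ≤ Set.ncard (p.roots.toFinset : Set F) := Set.ncard_le_ncard hsub (Finset.finite_toSet _)
    _ = p.roots.toFinset.card := Set.ncard_coe_finset _
    _ ≤ d := (Multiset.toFinset_card_le _).trans ((p.card_roots').trans hd)

open Polynomial in
lemma natCard_pow_eq_mul_le {F : Type*} [Field F] {q : ℕ} (hq : 1 < q) (t : F) :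
    Nat.card {x : F // x ^ q = t * x} ≤ q := by
  have hdeg : (X ^ q - C t * X : F[X]).natDegree = q := by
    compute_degree!
    · simp [hq.ne']
    all_goals exact hq.le
  refine natCard_le_of_forall_eval_eq_zero (X ^ q - C t * X) ?_ hdeg.le fun x hx => ?_
  · intro h
    rw [h, natDegree_zero] at hdeg
    omega
  · simp [hx]

open Polynomial in
lemma natCard_linearized_eq_zero_le {F : Type*} [Field F] {q : ℕ} (hq : 1 < q) (r s : F) {t : F}
    (ht : t ≠ 0) :
    Nat.card {x : F // r * x + s * x ^ q + t * x ^ q ^ 2 = 0} ≤ q ^ 2 := by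
  have hqq : q < q ^ 2 := by nlinarith
  have hdeg : (C r * X + C s * X ^ q + C t * X ^ q ^ 2 : F[X]).natDegree ≤ q ^ 2 := by
    compute_degree!
    omega
  refine natCard_le_of_forall_eval_eq_zero _ ?_ hdeg fun x hx => by simpa using hx
  intro h
  have := congrArg (fun p : F[X] => p.coeff (q ^ 2)) h
  simp [coeff_X, coeff_X_pow, hqq.ne', (hq.trans hqq).ne, ht] at this

/-- If an additive endomorphism of a group of order `q ^ 3` has kernel of order at most `q ^ 2` and
image in a set of at most `q` elements, then both bounds are attained. -/
lemma natCard_ker_and_image_eq {G : Type*} [AddCommGroup G] [Finite G] {q : ℕ} (hq : 0 < q)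
    (hG : Nat.card G = q ^ 3) (f : G →+ G) {P : G → Prop} (hP : ∀ x, P (f x))
    (hPq : Nat.card {x : G // P x} ≤ q) (hker : Nat.card {x : G // f x = 0} ≤ q ^ 2) :
    Nat.card {x : G // f x = 0} = q ^ 2 ∧ Nat.card {x : G // P x} = q := by
  have hrange : Nat.card f.range ≤ Nat.card {x : G // P x} :=
    Nat.card_le_card_of_injective
      (fun y : f.range => (⟨y.1, by obtain ⟨x, hx⟩ := y.2; exact hx ▸ hP x⟩ : {x : G // P x}))
      fun y z h => Subtype.ext (congrArg (fun w : {x : G // P x} => w.1) h)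
  have hmul : Nat.card f.range * Nat.card {x : G // f x = 0} = q ^ 3 := by
    rw [← hG, AddSubgroup.card_eq_card_quotient_mul_card_addSubgroup f.ker,
      Nat.card_congr (QuotientAddGroup.quotientKerEquivRange f).toEquiv]
    rfl
  generalize Nat.card {x : G // f x = 0} = k at *
  generalize Nat.card {x : G // P x} = p at *
  generalize Nat.card f.range = r at *
  have h2 : 0 < q ^ 2 := by positivity
  have hr : q ≤ r := by
    by_contra! hlt
    nlinarith [Nat.mul_le_mul_left r hker, Nat.mul_lt_mul_of_pos_right hlt h2]
  have hrq : r = q := by omega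
  subst hrq
  exact ⟨Nat.eq_of_mul_eq_mul_left hq (by rw [hmul]; ring), by omega⟩


/-- Let `q = 2^m`, `n = 3`, `F` the field with `q^3` elements and
`L(x) = a·x + b·x^q + c·x^(q^2)` with `L(1) = a + b + c = 0`.  The adjoint of `L` is
`L'(x) = a·x + (b·x)^(q^2) + (c·x)^q`.  Then `|ker Tr ∩ ker L'|` equals `1` if
`Tr(a^(q+1) + a^q·b + b^(q+1)) ≠ 0`; `q^2` if `a + b^(q^2) = 0` and `a + c^q = 0`;
and `q` otherwise. -/
theorem stmt_4 (m : ℕ) (hm : 0 < m)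
    (F : Type*) [Field F] [Fintype F] [DecidableEq F] (hF : Fintype.card F = 2 ^ (m * 3))
    (a b c : F) (habc : a + b + c = 0)
    (Tr L' : F → F)
    (hTr : ∀ x, Tr x = x + x ^ 2 ^ m + x ^ (2 ^ m) ^ 2)
    (hL' : ∀ x, L' x = a * x + (b * x) ^ (2 ^ m) ^ 2 + (c * x) ^ 2 ^ m) :
    Nat.card {x : F // Tr x = 0 ∧ L' x = 0} =
      if Tr (a ^ (2 ^ m + 1) + a ^ 2 ^ m * b + b ^ (2 ^ m + 1)) ≠ 0 then 1
      else if a + b ^ (2 ^ m) ^ 2 = 0 ∧ a + c ^ 2 ^ m = 0 then (2 ^ m) ^ 2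
      else 2 ^ m := by
  have h2prime : Fact (Nat.Prime 2) := ⟨Nat.prime_two⟩
  have : CharP F 2 := charP_of_card_eq_prime_pow hF
  have hq : 1 < 2 ^ m := Nat.one_lt_two_pow hm.ne'
  obtain ⟨σ, hσ⟩ : ∃ σ : F →+* F, ∀ x, x ^ 2 ^ m = σ x :=
    ⟨iterateFrobenius F 2 m, fun x => (iterateFrobenius_def 2 m x).symm⟩
  have hσ2 : ∀ x : F, x ^ (2 ^ m) ^ 2 = σ (σ x) := fun x => by
    rw [pow_two (2 ^ m), pow_mul, hσ, hσ]
  have hσ3 : ∀ x, σ (σ (σ x)) = x := fun x => by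
    rw [← hσ2, ← hσ, ← pow_mul]
    conv_rhs => rw [← FiniteField.pow_card x, hF]
    ring
  have hcard : Nat.card F = (2 ^ m) ^ 3 := by rw [Nat.card_eq_fintype_card, hF, pow_mul]
  have htwo : (2 : F) = 0 := CharTwo.two_eq_zero
  have hc : c = a + b := by linear_combination habc - (a + b) * htwo
  subst hc
  set A := a + σ (σ b) with hA
  set B := σ a + σ b + σ (σ b) with hB
  have hdet : Tr (a ^ (2 ^ m + 1) + a ^ 2 ^ m * b + b ^ (2 ^ m + 1)) =
      A * σ A + (A + B) * σ B := by
    simp only [hTr, hA, hB, pow_add, pow_one, hσ, hσ2, map_add, map_mul, hσ3]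
    linear_combination
      -(a * b + σ a * σ (σ b) + σ (σ b) * (σ (σ a) + σ (σ b) + b)) * htwo
  have hdeg : (a + b ^ (2 ^ m) ^ 2 = 0 ∧ a + (a + b) ^ 2 ^ m = 0) ↔ A = 0 ∧ B = 0 := by
    simp only [hσ, hσ2, map_add]
    refine and_congr_right fun h => ⟨fun h' => ?_, fun h' => ?_⟩
    · linear_combination h' - h + σ (σ b) * htwo
    · linear_combination h' + h - σ (σ b) * htwo
  have hmem : ∀ x, (Tr x = 0 ∧ L' x = 0) ↔ (x + σ x + σ (σ x) = 0 ∧ A * x + B * σ x = 0) := by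
    intro x
    simp only [hTr, hL', hσ, hσ2, map_add, map_mul]
    refine and_congr_right fun h => ⟨fun h' => ?_, fun h' => ?_⟩
    · rw [hA, hB]
      linear_combination h' - σ (σ b) * h + (σ (σ b) * x + σ (σ b) * σ x) * htwo
    · rw [hA, hB] at h'
      linear_combination h' + σ (σ b) * h - (σ (σ b) * x + σ (σ b) * σ x) * htwo
  rw [hdet, if_congr hdeg rfl rfl, Nat.card_congr (Equiv.subtypeEquivRight hmem)]
  clear_value A B
  split_ifs with hD hAB
  · rw [Nat.card_eq_one_iff_unique]
    refine ⟨⟨?_⟩, ⟨⟨0, by simp⟩⟩⟩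
    have hzero : ∀ x, x + σ x + σ (σ x) = 0 ∧ A * x + B * σ x = 0 → x = 0 := by
      rintro x ⟨h1, h2⟩
      have h3 := congrArg σ h2
      simp only [map_add, map_mul, map_zero] at h3
      refine (mul_eq_zero.mp ?_).resolve_left hD
      linear_combination (σ A - σ B) * h2 - B * h3 + B * σ B * h1 + A * σ B * x * htwo
    rintro ⟨x, hx⟩ ⟨y, hy⟩
    exact Subtype.ext ((hzero x hx).trans (hzero y hy).symm)
  · obtain ⟨rfl, rfl⟩ := hAB
    simp only [zero_mul, add_zero, and_true]
    refine (natCard_ker_and_image_eq (by omega) hcard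
      (AddMonoidHom.id F + σ.toAddMonoidHom + (σ.comp σ).toAddMonoidHom)
      (P := fun x => x ^ 2 ^ m = 1 * x) (fun x => ?_) (natCard_pow_eq_mul_le hq 1) ?_).1
    · simp [hσ, hσ3]
      ring
    · simpa [hσ, hσ2] using natCard_linearized_eq_zero_le hq (1 : F) 1 one_ne_zero
  · rw [not_not] at hD
    have hB0 : B ≠ 0 := by
      rintro rfl
      exact hAB ⟨by simpa using hD, rfl⟩
    have hσB0 : σ B ≠ 0 := by simpa using hB0
    obtain ⟨t, rfl⟩ : ∃ t, A = t * B := ⟨A / B, by field_simp⟩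
    have ht : t * σ t + t + 1 = 0 := by
      refine (mul_eq_zero.mp ?_).resolve_left (mul_ne_zero hB0 hσB0)
      rw [map_mul] at hD
      linear_combination hD
    have ht1 := congrArg σ ht
    have ht2 := congrArg σ ht1
    simp only [map_add, map_mul, map_one, map_zero, hσ3] at ht1 ht2
    have hnorm : t * σ t * σ (σ t) = 1 := by
      linear_combination σ (σ t) * ht - ht2
    have ht20 : σ (σ t) ≠ 0 := right_ne_zero_of_mul (hnorm ▸ one_ne_zero)
    have hiff : ∀ x, (x + σ x + σ (σ x) = 0 ∧ t * B * x + B * σ x = 0) ↔ x ^ 2 ^ m = t * x := by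
      intro x
      rw [hσ]
      constructor
      · rintro ⟨-, h⟩
        refine mul_left_cancel₀ hB0 ?_
        linear_combination h - B * t * x * htwo
      · intro h
        have h' := congrArg σ h
        rw [map_mul] at h'
        constructor
        · linear_combination h' + (1 + σ t) * h + x * ht
        · linear_combination B * h + B * t * x * htwo
    rw [Nat.card_congr (Equiv.subtypeEquivRight hiff)]
    refine (natCard_ker_and_image_eq (by omega) hcard
      (AddMonoidHom.id F + (AddMonoidHom.mulLeft (σ t * σ (σ t))).comp σ.toAddMonoidHom +
        (AddMonoidHom.mulLeft (σ (σ t))).comp (σ.comp σ).toAddMonoidHom)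
      (fun x => ?_) (natCard_pow_eq_mul_le hq t) ?_).2
    · simp [hσ, hσ3]
      linear_combination (-σ x) * hnorm
    · simpa [hσ, hσ2] using natCard_linearized_eq_zero_le hq (1 : F) (σ t * σ (σ t)) ht20
end

section
/- Let n = 3 and L(x) = (a·x + b·x^q + c·x^{q^2})^{2^k} be a polynomial over F_{q^3} for an integer k with 0 ≤ k < m, and set s = gcd(k-1, m). Then Tr(x^{q+1}) + L(x) is a permutation polynomial of F_{q^3} if and only if (a+b+c)^{(q-1)/(2^s-1)} ≠ 1, and either (1) a + b + c ∈ F_q^* and a^{q^2+q+1} + b^{q^2+q+1} + c^{q^2+q+1} + Tr(a·b^q·c^{q^2}) ≠ 0, or (2) a + b + c = 0 and Tr(a^{q+1} + a^q·b + b^{q+1}) ≠ 0. -/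
theorem IsCyclic.exists_pow_eq_of_pow_eq_one {G : Type*} [Group G] [Finite G] [IsCyclic G]
    {N d : ℕ} (hcard : Nat.card G = N * d) {x : G} (hx : x ^ N = 1) : ∃ z, z ^ d = x := by
  obtain ⟨g, hg⟩ := IsCyclic.exists_monoid_generator (α := G)
  obtain ⟨i, rfl⟩ := Submonoid.mem_powers_iff _ _ |>.1 (hg x)
  have hN : 0 < N := by
    rcases Nat.eq_zero_or_pos N with rfl | h
    · simp [Nat.card_pos.ne'] at hcard
    · exact h
  have hord : orderOf g = N * d := by
    rw [← hcard]
    refine orderOf_eq_card_of_forall_mem_zpowers fun y => ?_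
    obtain ⟨j, rfl⟩ := Submonoid.mem_powers_iff _ _ |>.1 (hg y)
    exact ⟨j, by simp⟩
  rw [← pow_mul, ← orderOf_dvd_iff_pow_eq_one, hord, mul_comm i N] at hx
  obtain ⟨j, rfl⟩ := Nat.dvd_of_mul_dvd_mul_left hN hx
  exact ⟨g ^ j, by rw [← pow_mul, mul_comm]⟩

/-- In a finite field, a `q`-linearized polynomial of `q`-degree at most two which vanishes
everywhere is zero, provided the field has more than `q ^ 2` elements. -/
theorem linearized_eq_zero_of_forall {F : Type*} [Field F] [Fintype F] {q : ℕ} (hq : 1 < q)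
    (hcard : q ^ 2 < Fintype.card F) {u v w : F}
    (h : ∀ t : F, u * t + v * t ^ q + w * t ^ q ^ 2 = 0) : u = 0 ∧ v = 0 ∧ w = 0 := by
  classical
  open Polynomial in
  set p : F[X] := C u * X + C v * X ^ q + C w * X ^ q ^ 2 with hp
  have hq2 : q < q ^ 2 := by nlinarith
  have hdeg : p.natDegree ≤ q ^ 2 := by
    rw [hp]
    compute_degree
    omega
  have hp0 : p = 0 := by
    refine Polynomial.eq_zero_of_natDegree_lt_card_of_eval_eq_zero' p Finset.univ
      (fun t _ => by simpa [hp] using h t) ?_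
    rw [Finset.card_univ]
    omega
  have hc (i : ℕ) : p.coeff i = 0 := by rw [hp0, Polynomial.coeff_zero]
  have h1 := hc 1
  have h2 := hc q
  have h3 := hc (q ^ 2)
  simp only [hp, Polynomial.coeff_add, Polynomial.coeff_C_mul, Polynomial.coeff_X,
    Polynomial.coeff_X_pow] at h1 h2 h3
  rw [if_pos trivial, if_neg (by omega), if_neg (by omega)] at h1
  rw [if_neg (by omega), if_pos trivial, if_neg (by omega)] at h2
  rw [if_neg (by omega), if_neg (by omega), if_pos trivial] at h3
  simp_all

section CubicExtension

variable {F : Type*} [Field F] {σ : F →+* F}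

/-- If the Dickson matrix of `y ↦ a y + b σ y + c σ² y` is nonsingular, the map is injective. -/
theorem linearized_ne_zero_of_det_ne_zero (hσ : ∀ x, σ (σ (σ x)) = x) {a b c y : F}
    (hdet : !![a, b, c; σ c, σ a, σ b; σ (σ b), σ (σ c), σ (σ a)].det ≠ 0)
    (hy : a * y + b * σ y + c * σ (σ y) = 0) : y = 0 := by
  have h1 := congrArg σ hy
  have h2 := congrArg σ h1
  simp only [map_add, map_mul, hσ, map_zero] at h1 h2
  by_contra hne
  refine hdet (Matrix.exists_mulVec_eq_zero_iff.1 ⟨![y, σ y, σ (σ y)], ?_, ?_⟩)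
  · exact fun h => hne (by simpa using congrFun h 0)
  · ext i
    fin_cases i <;> simp [Matrix.mulVec, dotProduct, Fin.sum_univ_three]
    · exact hy
    · linear_combination h1
    · linear_combination h2

/-- If the Dickson matrix of `y ↦ a y + b σ y + c σ² y` is singular, the map has a nontrivial
zero, by Galois descent. -/
theorem exists_linearized_eq_zero_of_det_eq_zero [Fintype F] {q : ℕ} (hq : 1 < q)
    (hcard : q ^ 2 < Fintype.card F) (hσq : ∀ x, σ x = x ^ q) (hσ : ∀ x, σ (σ (σ x)) = x)
    {a b c : F} (hdet : !![a, b, c; σ c, σ a, σ b; σ (σ b), σ (σ c), σ (σ a)].det = 0) :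
    ∃ y, y ≠ 0 ∧ a * y + b * σ y + c * σ (σ y) = 0 := by
  obtain ⟨v, hv, hmul⟩ := Matrix.exists_mulVec_eq_zero_iff.2 hdet
  have e0 := congrFun hmul 0
  have e1 := congrArg (fun x => σ (σ x)) (congrFun hmul 1)
  have e2 := congrArg σ (congrFun hmul 2)
  simp [Matrix.mulVec, dotProduct, Fin.sum_univ_three, hσ] at e0 e1 e2
  by_contra! hno
  refine hv ?_
  have key := linearized_eq_zero_of_forall hq hcard (u := v 0) (v := σ (v 2))
    (w := σ (σ (v 1))) fun t => by
      have hσσ : t ^ q ^ 2 = σ (σ t) := by rw [hσq, hσq, ← pow_mul, sq]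
      rw [hσσ, ← hσq]
      by_contra hne
      refine hno _ hne ?_
      simp only [map_add, map_mul, hσ]
      linear_combination t * e0 + σ (σ t) * e1 + σ t * e2
  simp only [map_eq_zero] at key
  ext i
  fin_cases i <;> simp [key]

/-- If the Dickson-type determinant of `z ↦ A z + B σ z` restricted to the trace-zero plane vanishes,
the map has a nontrivial zero of trace zero, by Hilbert 90. -/
theorem exists_of_reducedDet_eq_zero [Fintype F] [CharP F 2] {q : ℕ} (hq : 1 < q)
    (hcard : Fintype.card F = q ^ 3) (hσq : ∀ x, σ x = x ^ q) (hσ : ∀ x, σ (σ (σ x)) = x)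
    {A B : F} (hD : A * σ A + A * σ B + B * σ B = 0) :
    ∃ z, z ≠ 0 ∧ z + σ z + σ (σ z) = 0 ∧ A * z + B * σ z = 0 := by
  have two : (2 : F) = 0 := CharTwo.two_eq_zero
  by_cases hB : B = 0
  · have hA : A = 0 := by simpa [hB] using hD
    have hno : ¬ ∀ z : F, σ z = z := by
      intro h
      have := linearized_eq_zero_of_forall (F := F) hq (u := 1) (v := -1) (w := 0)
        (by rw [hcard]; exact Nat.pow_lt_pow_right hq (by norm_num))
        (fun t => by rw [← hσq, h]; ring)
      exact one_ne_zero this.1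
    push Not at hno
    obtain ⟨y, hy⟩ := hno
    refine ⟨σ y - y, sub_ne_zero.2 hy, ?_, by simp [hA, hB]⟩
    simp only [map_sub, hσ]
    ring
  · have hσB : σ B ≠ 0 := by simpa using hB
    have hA : A ≠ 0 := by
      rintro rfl
      simp [hB] at hD
    have hσA : σ A ≠ 0 := by simpa using hA
    have hr : A / B * σ (A / B) + A / B + 1 = 0 := by
      rw [map_div₀]
      field_simp
      linear_combination hD
    generalize hrdef : A / B = r at hr
    have hr0 : r ≠ 0 := by rw [← hrdef]; exact div_ne_zero hA hB
    have hr' := congrArg σ hr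
    simp only [map_add, map_mul, map_one, map_zero] at hr'
    have hnorm : r * σ r * σ (σ r) = 1 := by
      linear_combination r * hr' - hr
    obtain ⟨z, hz⟩ := IsCyclic.exists_pow_eq_of_pow_eq_one (G := Fˣ) (N := q ^ 2 + q + 1)
      (d := q - 1) (x := Units.mk0 r hr0)
      (by
        rw [Nat.card_units, Nat.card_eq_fintype_card, hcard]
        obtain ⟨p, rfl⟩ : ∃ p, q = p + 1 := ⟨q - 1, by omega⟩
        rw [Nat.add_sub_cancel]
        refine Nat.sub_eq_of_eq_add ?_
        ring)
      (by
        ext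
        simp only [Units.val_pow_eq_pow_val, Units.val_mk0, Units.val_one]
        rw [← hnorm, hσq, hσq]
        ring)
    have hz' : σ (z : F) = r * z := by
      have h := congrArg Units.val hz
      simp only [Units.val_pow_eq_pow_val, Units.val_mk0] at h
      rw [hσq, ← h, ← pow_succ, Nat.sub_add_cancel hq.le]
    refine ⟨z, z.ne_zero, ?_, ?_⟩
    · rw [hz', map_mul, hz']
      linear_combination (z : F) * hr
    · rw [hz', ← hrdef]
      field_simp
      linear_combination A * z * two

/-- The case of `y ↦ a y + b σ y + c σ² y` killing the fixed field. -/
theorem forall_fixed_iff_of_sum_eq_zero [Fintype F] [CharP F 2] {q : ℕ} (hq : 1 < q)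
    (hcard : Fintype.card F = q ^ 3) (hσq : ∀ x, σ x = x ^ q) (hσ : ∀ x, σ (σ (σ x)) = x)
    {a b c : F} (habc : a + b + c = 0) :
    (∀ y, σ (a * y + b * σ y + c * σ (σ y)) = a * y + b * σ y + c * σ (σ y) → σ y = y) ↔
      (σ a * a + σ a * b + σ b * b) + σ (σ a * a + σ a * b + σ b * b) +
        σ (σ (σ a * a + σ a * b + σ b * b)) ≠ 0 := by
  have two : (2 : F) = 0 := CharTwo.two_eq_zero
  obtain rfl : c = a + b := by linear_combination habc - (a + b) * two
  set A := a + σ a + σ b with hA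
  set B := a + b + σ b with hB
  have hD : (σ a * a + σ a * b + σ b * b) + σ (σ a * a + σ a * b + σ b * b) +
      σ (σ (σ a * a + σ a * b + σ b * b)) = A * σ A + A * σ B + B * σ B := by
    simp only [hA, hB, map_add, map_mul, hσ]
    linear_combination -(a * σ a + a * σ (σ b) + a * σ b + σ a * σ (σ b) + 2 * (σ a * σ b) +
      σ a ^ 2 + σ (σ b) * σ b + σ b ^ 2) * two
  have hM (y : F) : σ (a * y + b * σ y + (a + b) * σ (σ y)) -
      (a * y + b * σ y + (a + b) * σ (σ y)) = A * (y + σ y) + B * σ (y + σ y) := by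
    simp only [hA, hB, map_add, map_mul, hσ]
    linear_combination
      -(σ y * σ b + σ y * a + σ y * b + σ (σ y) * a + σ (σ y) * b + y * a) * two
  rw [hD]
  constructor
  · intro h h0
    obtain ⟨z, hz0, hztr, hz⟩ := exists_of_reducedDet_eq_zero hq hcard hσq hσ h0
    have hy : σ z + σ (σ z) = z := by linear_combination hztr - z * two
    have h1 := h (σ z) (sub_eq_zero.1 (by rw [hM, hy, hz]))
    refine hz0 ?_
    rw [← hy, h1]
    linear_combination σ z * two
  · intro h y hy
    rw [← sub_eq_zero, hM] at hy
    have hy' := congrArg σ hy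
    have hz : (A * σ A + A * σ B + B * σ B) * (y + σ y) = 0 := by
      simp only [map_add, map_mul, map_zero, hσ] at hy hy' ⊢
      linear_combination (σ A + σ B) * hy + B * hy' -
        (B * σ A * (σ y + σ (σ y)) + B * σ B * σ (σ y)) * two
    have := (mul_eq_zero.1 hz).resolve_left h
    linear_combination this - y * two

/-- The case of `y ↦ a y + b σ y + c σ² y` preserving the fixed field. -/
theorem forall_fixed_iff_of_sum_ne_zero [Fintype F] {q : ℕ} (hq : 1 < q)
    (hcard : Fintype.card F = q ^ 3) (hσq : ∀ x, σ x = x ^ q) (hσ : ∀ x, σ (σ (σ x)) = x)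
    {a b c : F} (he : a + b + c ≠ 0) (hfix : σ (a + b + c) = a + b + c) :
    (∀ y, σ (a * y + b * σ y + c * σ (σ y)) = a * y + b * σ y + c * σ (σ y) → σ y = y) ↔
      !![a, b, c; σ c, σ a, σ b; σ (σ b), σ (σ c), σ (σ a)].det ≠ 0 := by
  constructor
  · intro h hdet
    obtain ⟨y, hy0, hy⟩ := exists_linearized_eq_zero_of_det_eq_zero hq
      (by rw [hcard]; exact Nat.pow_lt_pow_right hq (by norm_num)) hσq hσ hdet
    have h1 := h y (by rw [hy, map_zero])
    rw [h1, h1, ← add_mul, ← add_mul] at hy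
    exact (mul_ne_zero he hy0) hy
  · intro hdet y hy
    set t := a * y + b * σ y + c * σ (σ y) with ht
    have hfix' : σ (t / (a + b + c)) = t / (a + b + c) := by rw [map_div₀, hy, hfix]
    have h0 : y - t / (a + b + c) = 0 := by
      refine linearized_ne_zero_of_det_ne_zero hσ hdet ?_
      rw [map_sub, map_sub, hfix', hfix']
      linear_combination -ht - div_mul_cancel₀ t he
    rw [sub_eq_zero.1 h0, hfix']

theorem sum_fixed_of_forall_fixed [Finite F] [CharP F 2] (hσ : ∀ x, σ (σ (σ x)) = x) {a b c : F}
    (h : ∀ y, σ (a * y + b * σ y + c * σ (σ y)) = a * y + b * σ y + c * σ (σ y) → σ y = y) :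
    σ (a + b + c) = a + b + c := by
  let g : F →+ F :=
    { toFun y := σ (a * y + b * σ y + c * σ (σ y)) - (a * y + b * σ y + c * σ (σ y))
      map_zero' := by simp
      map_add' x y := by simp only [map_add, mul_add]; ring }
  have hg (y : F) : g y =
    σ (a * y + b * σ y + c * σ (σ y)) - (a * y + b * σ y + c * σ (σ y)) := rfl
  have hnot : ¬ Function.Injective g := by
    intro hinj
    obtain ⟨y, hy⟩ := Finite.surjective_of_injective hinj 1
    have htr : g y + σ (g y) + σ (σ (g y)) = 0 := by
      simp only [hg, map_sub, hσ]
      ring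
    rw [hy, map_one, map_one] at htr
    exact one_ne_zero (by linear_combination htr - CharTwo.two_eq_zero (R := F))
  rw [injective_iff_map_eq_zero] at hnot
  push Not at hnot
  obtain ⟨y, hy, hy0⟩ := hnot
  rw [hg, sub_eq_zero] at hy
  have hfix := h y hy
  rw [hfix, hfix, ← add_mul, ← add_mul, map_mul, hfix] at hy
  exact mul_right_cancel₀ hy0 hy

/-- Injectivity of `Tr (σ x * x) + ψ (a x + b σ x + c σ² x)`, tested on differences. -/
theorem injective_iff_forall_fixed [CharP F 2] (hσ : ∀ x, σ (σ (σ x)) = x) (ψ : F →+* F)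
    (hψ : ∀ x, σ (ψ x) = ψ (σ x)) (a b c : F) :
    Function.Injective (fun x => (σ x * x + σ (σ x * x) + σ (σ (σ x * x))) +
        ψ (a * x + b * σ x + c * σ (σ x))) ↔
      (∀ y, σ y = y → y ≠ 0 → y ^ 2 ≠ ψ ((a + b + c) * y)) ∧
      ∀ y, σ (a * y + b * σ y + c * σ (σ y)) = a * y + b * σ y + c * σ (σ y) → σ y = y := by
  have two : (2 : F) = 0 := CharTwo.two_eq_zero
  set f : F → F := fun x => (σ x * x + σ (σ x * x) + σ (σ (σ x * x))) +
    ψ (a * x + b * σ x + c * σ (σ x)) with hf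
  set T : F → F := fun x => x + σ x + σ (σ x) with hT
  have hdiff (x y : F) : f (x + y) = f x +
      (T (σ y * y) + T (x * (σ y + σ (σ y))) + ψ (a * y + b * σ y + c * σ (σ y))) := by
    simp only [hf, hT, map_add, map_mul, hσ]
    ring
  have hTfix (x : F) : σ (T x) = T x := by
    simp only [hT, map_add, hσ]
    ring
  have hfixed {y : F} (hy : σ y = y) (x : F) : T (σ y * y) + T (x * (σ y + σ (σ y))) +
      ψ (a * y + b * σ y + c * σ (σ y)) = y ^ 2 - ψ ((a + b + c) * y) := by
    simp only [hT, hy, map_mul, map_add]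
    linear_combination (y ^ 2 + x * y + σ x * y + σ (σ x) * y +
      (ψ a + ψ b + ψ c) * ψ y) * two
  constructor
  · intro hinj
    refine ⟨fun y hy hy0 h => hy0 ?_, fun y hy => ?_⟩
    · refine add_eq_left.1 (hinj (a₁ := 0 + y) (a₂ := 0) ?_)
      rw [hdiff, hfixed hy, h, sub_self, add_zero]
    · by_contra hne
      have hu : σ y + σ (σ y) ≠ 0 := by
        intro hu
        have hu' := congrArg σ hu
        simp only [map_add, hσ, map_zero] at hu'
        exact hne (by linear_combination hu - hu')
      set t := -(T (σ y * y) + ψ (a * y + b * σ y + c * σ (σ y))) with ht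
      have htfix : σ t = t := by rw [ht, map_neg, map_add, hTfix, hψ, hy]
      have hTt : T t = t := by
        simp only [hT, htfix]
        linear_combination t * two
      have hy0 : y = 0 := by
        refine add_eq_left.1 (hinj (a₁ := t / (σ y + σ (σ y)) + y) ?_)
        rw [hdiff, div_mul_cancel₀ _ hu, hTt, ht]
        ring
      exact hne (by rw [hy0, map_zero])
  · rintro ⟨h1, h2⟩ x x' hxx
    obtain ⟨y, rfl⟩ : ∃ y, x' = x + y := ⟨x' - x, by ring⟩
    rw [hdiff, left_eq_add] at hxx
    by_cases hy : σ y = y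
    · rw [hfixed hy, sub_eq_zero] at hxx
      by_contra hne
      exact h1 y hy (fun h => hne (by rw [h, add_zero])) hxx
    · refine absurd (h2 y (ψ.injective ?_)) hy
      rw [← hψ, eq_neg_of_add_eq_zero_right hxx, map_neg, map_add, hTfix, hTfix]

end CubicExtension

theorem IsCyclic.exists_pow_mul_eq_one {G : Type*} [CommGroup G] [Finite G] [IsCyclic G]
    {N d r : ℕ} (hdvd : N * d ∣ Nat.card G) (hd : r.gcd (N * d) = d) {x : G} (hx : x ^ N = 1) :
    ∃ y, y ^ (N * d) = 1 ∧ y ^ r * x = 1 := by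
  obtain ⟨c, hc⟩ := hdvd
  obtain ⟨z, rfl⟩ := IsCyclic.exists_pow_eq_of_pow_eq_one (hc.trans (mul_assoc N d c)) hx
  have hw : (z ^ c) ^ (N * d) = 1 := by
    rw [← pow_mul, mul_comm c, ← hc, pow_card_eq_one']
  rw [mul_comm d c, pow_mul]
  generalize z ^ c = w at hw
  have hbez := Nat.gcd_eq_gcd_ab r (N * d)
  rw [hd] at hbez
  refine ⟨w ^ (-r.gcdA (N * d)), ?_, ?_⟩
  · rw [← zpow_natCast, zpow_comm, zpow_natCast, hw, one_zpow]
  · rw [← zpow_natCast, ← zpow_natCast w d, ← zpow_mul, ← zpow_add, hbez,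
      show -r.gcdA (N * d) * r + (r * r.gcdA (N * d) + ((N * d : ℕ) : ℤ) * r.gcdB (N * d)) =
        ((N * d : ℕ) : ℤ) * r.gcdB (N * d) by ring, zpow_mul, zpow_natCast, hw, one_zpow]

theorem exists_fixed_sq_eq_pow_iff {F : Type*} [Field F] [Fintype F] [CharP F 2] {m k s : ℕ}
    (hm : 0 < m) (hF : Fintype.card F = 2 ^ (m * 3)) (hs : s = Int.gcd ((k : ℤ) - 1) (m : ℤ))
    {e : F} (he : e ≠ 0) (hfix : e ^ 2 ^ m = e) :
    (∃ y, y ^ 2 ^ m = y ∧ y ≠ 0 ∧ y ^ 2 = (e * y) ^ 2 ^ k) ↔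
      e ^ ((2 ^ m - 1) / (2 ^ s - 1)) = 1 := by
  have hone {x : F} (hx : x ≠ 0) : x ^ 2 ^ m = x ↔ x ^ (2 ^ m - 1) = 1 := by
    conv_lhs => rw [← Nat.sub_add_cancel (Nat.one_le_two_pow (n := m)), pow_succ]
    exact mul_eq_right₀ hx
  rcases k with _ | j
  · obtain rfl : s = 1 := by simpa using hs
    simp only [pow_zero, pow_one]
    rw [show 2 - 1 = 1 from rfl, Nat.div_one, ← hone he]
    exact iff_of_true ⟨e, hfix, he, sq e⟩ hfix
  · obtain rfl : s = j.gcd m := by simpa [Int.gcd] using hs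
    have hgcd := Nat.pow_sub_one_gcd_pow_sub_one 2 j m
    have hspos : 0 < 2 ^ j.gcd m - 1 := by
      have := Nat.one_lt_two_pow (Nat.gcd_pos_of_pos_right j hm).ne'
      omega
    generalize 2 ^ j.gcd m - 1 = d at *
    obtain ⟨N, hN⟩ : d ∣ 2 ^ m - 1 := hgcd ▸ Nat.gcd_dvd_right _ _
    obtain ⟨l, hl⟩ : d ∣ 2 ^ j - 1 := hgcd ▸ Nat.gcd_dvd_left _ _
    rw [hN, Nat.mul_div_cancel_left _ hspos]
    rw [hN, mul_comm] at hgcd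
    have hj : 2 ^ j = d * l + 1 := by rw [← hl, Nat.sub_add_cancel Nat.one_le_two_pow]
    have hsq (y : F) : y ^ 2 = (e * y) ^ 2 ^ (j + 1) ↔ y = (e * y) ^ 2 ^ j := by
      rw [pow_succ 2 j, pow_mul]
      exact (frobenius_inj F 2).eq_iff
    constructor
    · rintro ⟨y, hy, hy0, h⟩
      rw [hone hy0, hN] at hy
      rw [hsq, mul_pow] at h
      have h' : e ^ 2 ^ j * y ^ (d * l) = 1 := by
        refine mul_right_cancel₀ hy0 ?_
        rw [mul_assoc, ← pow_succ, ← hj, ← h, one_mul]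
      have h'' := congrArg (· ^ N) h'
      simp only [mul_pow, one_pow] at h''
      rw [← pow_mul y, show d * l * N = d * N * l by ring, pow_mul, hy, one_pow, mul_one,
        ← pow_mul, mul_comm, pow_mul] at h''
      refine iterateFrobenius_inj F 2 j ?_
      rw [iterateFrobenius_def, h'', map_one]
    · intro h
      have hdvd : N * d ∣ Nat.card Fˣ := by
        rw [Nat.card_units, Nat.card_eq_fintype_card, hF, mul_comm N, ← hN]
        exact Nat.pow_sub_one_dvd_pow_sub_one 2 ⟨3, rfl⟩
      obtain ⟨y, hy, hyr⟩ := IsCyclic.exists_pow_mul_eq_one (x := Units.mk0 e he ^ 2 ^ j)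
        hdvd hgcd (by
          ext
          simp only [Units.val_pow_eq_pow_val, Units.val_mk0, Units.val_one]
          rw [← pow_mul, mul_comm, pow_mul, h, one_pow])
      have hy' := congrArg Units.val hy
      have hyr' := congrArg Units.val hyr
      simp only [Units.val_mul, Units.val_pow_eq_pow_val, Units.val_one, Units.val_mk0]
        at hy' hyr'
      refine ⟨y, ?_, y.ne_zero, ?_⟩
      · rw [hone y.ne_zero, hN, mul_comm, hy']
      · rw [hsq, mul_pow]
        conv_rhs => rw [← Nat.sub_add_cancel (Nat.one_le_two_pow (n := j)), pow_succ (y : F)]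
        rw [Nat.sub_add_cancel Nat.one_le_two_pow]
        linear_combination -(y : F) * hyr'


/-- Let `q = 2^m`, `n = 3`, `F` the field with `q^3` elements and
`L(x) = (a·x + b·x^q + c·x^(q^2))^(2^k)` with `0 ≤ k < m`, `s = gcd(k-1, m)`.  Then
`Tr(x^(q+1)) + L(x)` is a permutation polynomial of `F` iff
`(a+b+c)^((q-1)/(2^s-1)) ≠ 1` and either (1) `a+b+c ∈ F_q^*` and
`a^(q^2+q+1) + b^(q^2+q+1) + c^(q^2+q+1) + Tr(a·b^q·c^(q^2)) ≠ 0`, or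
(2) `a+b+c = 0` and `Tr(a^(q+1) + a^q·b + b^(q+1)) ≠ 0`. -/
theorem stmt_5 (m : ℕ) (hm : 0 < m)
    (F : Type*) [Field F] [Fintype F] (hF : Fintype.card F = 2 ^ (m * 3))
    (a b c : F) (k : ℕ) (hk : k < m)
    (s : ℕ) (hs : s = Int.gcd ((k : ℤ) - 1) (m : ℤ))
    (Tr : F → F)
    (hTr : ∀ x, Tr x = x + x ^ 2 ^ m + x ^ (2 ^ m) ^ 2) :
    Function.Bijective (fun x : F =>
        Tr (x ^ (2 ^ m + 1)) + (a * x + b * x ^ 2 ^ m + c * x ^ (2 ^ m) ^ 2) ^ 2 ^ k) ↔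
      ((a + b + c) ^ ((2 ^ m - 1) / (2 ^ s - 1)) ≠ 1 ∧
        ((a + b + c ≠ 0 ∧ (a + b + c) ^ 2 ^ m = a + b + c ∧
            a ^ ((2 ^ m) ^ 2 + 2 ^ m + 1) + b ^ ((2 ^ m) ^ 2 + 2 ^ m + 1) +
                c ^ ((2 ^ m) ^ 2 + 2 ^ m + 1) +
                Tr (a * b ^ 2 ^ m * c ^ (2 ^ m) ^ 2) ≠ 0) ∨
          (a + b + c = 0 ∧
            Tr (a ^ (2 ^ m + 1) + a ^ 2 ^ m * b + b ^ (2 ^ m + 1)) ≠ 0))) := by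
  have : CharP F 2 := by
    have := Fact.mk Nat.prime_two
    exact charP_of_card_eq_prime_pow hF
  set σ : F →+* F := iterateFrobenius F 2 m
  set ψ : F →+* F := iterateFrobenius F 2 k
  have hq : 1 < 2 ^ m := Nat.one_lt_two_pow hm.ne'
  have hcard : Fintype.card F = (2 ^ m) ^ 3 := by rw [hF, pow_mul]
  have hσq (x : F) : σ x = x ^ 2 ^ m := iterateFrobenius_def 2 m x
  have hψq (x : F) : ψ x = x ^ 2 ^ k := iterateFrobenius_def 2 k x
  have hσ (x : F) : σ (σ (σ x)) = x := by
    rw [hσq, hσq, hσq, ← pow_mul, ← pow_mul, ← sq, ← pow_succ', ← hcard,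
      FiniteField.pow_card]
  have hψ (x : F) : σ (ψ x) = ψ (σ x) := by
    rw [hσq, hσq, hψq, hψq, ← pow_mul, ← pow_mul, mul_comm]
  have hσσ (x : F) : x ^ (2 ^ m) ^ 2 = σ (σ x) := by rw [hσq, hσq, ← pow_mul x, sq]
  have hN : (2 ^ m - 1) / (2 ^ s - 1) ≠ 0 := by
    have hsm : s ∣ m := by
      rw [hs]
      exact Int.natCast_dvd_natCast.1 (Int.gcd_dvd_right _ _)
    have hs0 : 0 < s := Nat.pos_of_dvd_of_pos hsm hm
    have h1 := Nat.one_lt_two_pow hs0.ne'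
    have h2 := Nat.pow_le_pow_right (n := 2) two_pos (Nat.le_of_dvd hm hsm)
    exact (Nat.div_pos (by omega) (by omega)).ne'
  simp only [hTr, pow_add, pow_one, hσσ, ← hσq, ← hψq]
  rw [← Finite.injective_iff_bijective]
  have hdet : !![a, b, c; σ c, σ a, σ b; σ (σ b), σ (σ c), σ (σ a)].det =
      σ (σ a) * σ a * a + σ (σ b) * σ b * b + σ (σ c) * σ c * c +
        (a * σ b * σ (σ c) + σ (a * σ b * σ (σ c)) + σ (σ (a * σ b * σ (σ c)))) := by
    rw [Matrix.det_fin_three]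
    simp [hσ]
    linear_combination -(a * σ b * σ (σ c) + b * σ c * σ (σ a) + c * σ a * σ (σ b)) *
      CharTwo.two_eq_zero (R := F)
  rw [injective_iff_forall_fixed hσ ψ hψ]
  constructor
  · rintro ⟨h1, h2⟩
    have hfix := sum_fixed_of_forall_fixed hσ h2
    by_cases he : a + b + c = 0
    · refine ⟨by rw [he, zero_pow hN]; exact zero_ne_one, Or.inr ⟨he, ?_⟩⟩
      exact (forall_fixed_iff_of_sum_eq_zero hq hcard hσq hσ he).1 h2
    · refine ⟨fun h => ?_, Or.inl ⟨he, hfix, ?_⟩⟩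
      · rw [hσq] at hfix
        obtain ⟨y, hy, hy0, hye⟩ := (exists_fixed_sq_eq_pow_iff hm hF hs he hfix).2 h
        exact h1 y (by rwa [hσq]) hy0 (by rwa [hψq])
      · exact hdet ▸ (forall_fixed_iff_of_sum_ne_zero hq hcard hσq hσ he hfix).1 h2
  · rintro ⟨h, ⟨he, hfix, h0⟩ | ⟨he, h0⟩⟩
    · refine ⟨fun y hy hy0 hye => h ?_, ?_⟩
      · rw [hσq] at hfix hy
        rw [hψq] at hye
        exact (exists_fixed_sq_eq_pow_iff hm hF hs he hfix).1 ⟨y, hy, hy0, hye⟩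
      · exact (forall_fixed_iff_of_sum_ne_zero hq hcard hσq hσ he hfix).2 (hdet ▸ h0)
    · refine ⟨fun y _ hy0 hye => hy0 ?_, ?_⟩
      · simpa [he] using hye
      · exact (forall_fixed_iff_of_sum_eq_zero hq hcard hσq hσ he).2 h0
end

section
/- Let L(x) = Σ_{i=0}^{m-1} L_i(x^{2^i}) where each L_i is a q-linear polynomial over F_{q^n}. Then L'(ker Tr) ⊆ ker Tr if and only if L_i(1) ∈ F_q for all 0 ≤ i < m; and in that case there exists a unique map l on F_q such that Tr(L'(x)) = l(Tr(x)) for all x ∈ F_{q^n}, given by l(x) = Σ_{i=0}^{m-1} (L_i(1)·x)^{2^{m-i}}. -/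
open Finset Polynomial in
/-- Power functions with distinct exponents below the cardinality of a finite field are linearly
independent. -/
theorem FiniteField.eq_zero_of_sum_mul_pow_eq_zero {F ι : Type*} [Field F] [Fintype F] [Fintype ι]
    {e : ι → ℕ} (he : Function.Injective e) (hlt : ∀ i, e i < Fintype.card F) {a : ι → F}
    (h : ∀ x, ∑ i, a i * x ^ e i = 0) (i : ι) : a i = 0 := by
  classical
  let p : F[X] := ∑ i, C (a i) * X ^ e i
  have hp : p = 0 := by
    refine eq_zero_of_degree_lt_of_eval_finset_eq_zero univ ?_ ?_
    · refine (degree_sum_le _ _).trans_lt ((Finset.sup_lt_iff ?_).2 fun i _ ↦ ?_)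
      · exact WithBot.bot_lt_coe _
      · exact (degree_C_mul_X_pow_le _ _).trans_lt (by exact_mod_cast hlt i)
    · intro x _
      simpa [p, eval_finsetSum] using h x
  have hc : p.coeff (e i) = a i := by
    simp [p, coeff_C_mul, coeff_X_pow, he.eq_iff]
  rw [← hc, hp, coeff_zero]

/-- The sum `x + x ^ q + ⋯ + x ^ q ^ (n - 1)`, which is the trace from `F_{q^n}` to `F_q`. -/
def powTrace {F : Type*} [Field F] (q n : ℕ) (x : F) : F :=
  ∑ i ∈ Finset.range n, x ^ q ^ i

section powTrace

variable {F : Type*} [Field F] {q n : ℕ}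

theorem powTrace_mul {a : F} (ha : a ^ q = a) (x : F) :
    powTrace q n (a * x) = a * powTrace q n x := by
  have h (i : ℕ) : a ^ q ^ i = a := by
    induction i with
    | zero => simp
    | succ i ih => rw [pow_succ, pow_mul, ih, ha]
  simp [powTrace, mul_pow, h, Finset.mul_sum]

theorem powTrace_pow_self [Fintype F] (hF : Fintype.card F = q ^ n) (x : F) :
    powTrace q n (x ^ q) = powTrace q n x := by
  have h := Finset.sum_range_succ' (fun i ↦ x ^ q ^ i) n
  rw [Finset.sum_range_succ, ← hF, FiniteField.pow_card, pow_zero, pow_one] at h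
  simpa [powTrace, ← pow_mul, ← pow_succ'] using (add_right_cancel h).symm

theorem powTrace_pow_two_pow [CharP F 2] (s : ℕ) (x : F) :
    powTrace q n (x ^ 2 ^ s) = powTrace q n x ^ 2 ^ s := by
  simp only [powTrace, sum_pow_char_pow, ← pow_mul, mul_comm]

theorem powTrace_sum [CharP F 2] {ι : Type*} (m : ℕ) (s : Finset ι) (f : ι → F) :
    powTrace (2 ^ m) n (∑ i ∈ s, f i) = ∑ i ∈ s, powTrace (2 ^ m) n (f i) := by
  simp only [powTrace, ← pow_mul, sum_pow_char_pow]
  exact Finset.sum_comm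

theorem powTrace_add [CharP F 2] (m : ℕ) (x y : F) :
    powTrace (2 ^ m) n (x + y) = powTrace (2 ^ m) n x + powTrace (2 ^ m) n y := by
  simp only [powTrace, ← pow_mul, add_pow_char_pow, Finset.sum_add_distrib]

theorem powTrace_pow_card [Fintype F] [CharP F 2] {m : ℕ}
    (hF : Fintype.card F = (2 ^ m) ^ n) (x : F) :
    powTrace (2 ^ m) n x ^ 2 ^ m = powTrace (2 ^ m) n x := by
  rw [← powTrace_pow_two_pow, powTrace_pow_self hF]

theorem powTrace_pow_two_pow_add_mul [Fintype F] [CharP F 2] {m : ℕ}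
    (hF : Fintype.card F = (2 ^ m) ^ n) (x : F) (s k : ℕ) :
    powTrace (2 ^ m) n x ^ 2 ^ (s + m * k) = powTrace (2 ^ m) n x ^ 2 ^ s := by
  induction k with
  | zero => simp
  | succ k ih =>
    rw [mul_add, mul_one, ← add_assoc, pow_add, mul_comm, pow_mul, powTrace_pow_card hF, ih]

theorem exists_powTrace_ne_zero [Fintype F] (hq : 1 < q) (hn : 0 < n)
    (hF : Fintype.card F = q ^ n) : ∃ x : F, powTrace q n x ≠ 0 := by
  by_contra! h
  refine one_ne_zero (FiniteField.eq_zero_of_sum_mul_pow_eq_zero (F := F) (a := fun _ ↦ 1)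
    (e := fun i : Fin n ↦ q ^ (i : ℕ)) ?_ ?_ (fun x ↦ ?_) ⟨0, hn⟩)
  · exact fun i j hij ↦ Fin.ext (Nat.pow_right_injective hq hij)
  · exact fun i ↦ hF ▸ Nat.pow_lt_pow_right hq i.2
  · simpa [powTrace, Finset.sum_range] using h x

theorem exists_powTrace_eq [Fintype F] [CharP F 2] {m : ℕ} (hm : 0 < m) (hn : 0 < n)
    (hF : Fintype.card F = (2 ^ m) ^ n) {y : F} (hy : y ^ 2 ^ m = y) :
    ∃ x : F, powTrace (2 ^ m) n x = y := by
  obtain ⟨x, hx⟩ := exists_powTrace_ne_zero (Nat.one_lt_two_pow hm.ne') hn hF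
  refine ⟨y / powTrace (2 ^ m) n x * x, ?_⟩
  rw [powTrace_mul (by rw [div_pow, hy, powTrace_pow_card hF]), div_mul_cancel₀ _ hx]

/-- If `x ↦ Tr (b x)` vanishes on the kernel of the trace, then `b` lies in the base field. -/
theorem pow_eq_self_of_powTrace_mul_eq_zero [Fintype F] [CharP F 2] {m : ℕ} (hm : 0 < m)
    (hn : 0 < n) (hF : Fintype.card F = (2 ^ m) ^ n) {b : F}
    (h : ∀ x, powTrace (2 ^ m) n x = 0 → powTrace (2 ^ m) n (b * x) = 0) :
    b ^ 2 ^ m = b := by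
  have key (u : F) : powTrace (2 ^ m) n ((b ^ 2 ^ m + b) * u ^ 2 ^ m) = 0 := by
    have hu := h (u + u ^ 2 ^ m) (by
      rw [powTrace_add, powTrace_pow_self hF, CharTwo.add_self_eq_zero])
    rw [mul_add, powTrace_add] at hu
    rw [add_mul, powTrace_add, ← mul_pow, powTrace_pow_self hF, hu]
  by_contra hb
  have hd : b ^ 2 ^ m + b ≠ 0 := fun h0 ↦ hb (CharTwo.add_eq_zero.1 h0)
  obtain ⟨x, hx⟩ := exists_powTrace_ne_zero (Nat.one_lt_two_pow hm.ne') hn hF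
  obtain ⟨u, hu⟩ := (bijective_iterateFrobenius F 2 m).2 (x / (b ^ 2 ^ m + b))
  rw [iterateFrobenius_def] at hu
  exact hx (by simpa [hu, mul_div_cancel₀ _ hd] using key u)

/-- The coefficients of a combination of distinct powers `Tr w ^ 2 ^ (m - i)` that vanishes
for all `w` are zero. -/
theorem eq_zero_of_sum_powTrace_mul_pow_eq_zero [Fintype F] [CharP F 2] {m : ℕ} (hn : 0 < n)
    (hF : Fintype.card F = (2 ^ m) ^ n) {B : Fin m → F}
    (h : ∀ w, ∑ i : Fin m, (powTrace (2 ^ m) n w * B i) ^ 2 ^ (m - (i : ℕ)) = 0) (i : Fin m) :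
    B i = 0 := by
  have hlt (p : Fin m × Fin n) : m - 1 - (p.1 : ℕ) + m * p.2 < m * n := by
    have h1 := p.1.2
    have h2 : m * ((p.2 : ℕ) + 1) ≤ m * n := Nat.mul_le_mul_left m p.2.2
    rw [mul_add] at h2
    omega
  have key := FiniteField.eq_zero_of_sum_mul_pow_eq_zero (F := F)
    (e := fun p : Fin m × Fin n ↦ 2 ^ (m - 1 - (p.1 : ℕ) + m * (p.2 : ℕ)))
    (a := fun p ↦ B p.1 ^ 2 ^ (m - 1 - (p.1 : ℕ))) ?_ ?_ (fun w ↦ ?_) (i, ⟨0, hn⟩)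
  · exact eq_zero_of_pow_eq_zero key
  · rintro ⟨i, j⟩ ⟨i', j'⟩ hij
    have hij := Nat.pow_right_injective le_rfl hij
    have h1 := i.2
    have h2 := i'.2
    have hmod := congrArg (· % m) hij
    have hdiv := congrArg (· / m) hij
    simp only [Nat.add_mul_mod_self_left] at hmod
    rw [Nat.mod_eq_of_lt (by omega), Nat.mod_eq_of_lt (by omega)] at hmod
    simp only [Nat.add_mul_div_left _ _ i.pos] at hdiv
    rw [Nat.div_eq_of_lt (by omega), Nat.div_eq_of_lt (by omega)] at hdiv
    ext <;> dsimp only <;> omega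
  · intro p
    rw [hF, ← pow_mul]
    exact Nat.pow_lt_pow_right one_lt_two (hlt p)
  · refine eq_zero_of_pow_eq_zero (n := 2) ((Eq.trans ?_ (h w)))
    rw [Fintype.sum_prod_type, sum_pow_char 2]
    refine Finset.sum_congr rfl fun i _ ↦ ?_
    have h1 : m - (i : ℕ) = m - 1 - i + 1 := by omega
    rw [h1, pow_succ 2 (m - 1 - (i : ℕ)), pow_mul, mul_pow, powTrace, sum_pow_char_pow, Finset.sum_range,
      Finset.sum_mul]
    refine congrArg (· ^ 2) (Finset.sum_congr rfl fun j _ ↦ ?_)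
    rw [mul_comm, ← pow_mul, ← pow_mul, ← pow_add, add_comm]

end powTrace

/-- Let `q = 2^m`, `F` the field with `q^n` elements, and
`L(x) = Σ_{i<m} L_i(x^(2^i))` with `L_i(x) = Σ_{j<n} c i j · x^(q^j)` `q`-linear, so
`L'(x) = Σ_{i<m} Σ_{j<n} (c i j · x)^(2^(m·n - (i + m·j)))`.  Then `L'(ker Tr) ⊆ ker Tr`
iff `L_i(1) ∈ F_q` for all `i`; in that case there is a unique map `l` on `F_q` with
`Tr(L'(x)) = l(Tr x)`, given by `l(x) = Σ_{i<m} (L_i(1)·x)^(2^(m-i))`. -/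
theorem stmt_6 (m n : ℕ) (hm : 0 < m) (hn : 0 < n)
    (F : Type*) [Field F] [Fintype F] (hF : Fintype.card F = 2 ^ (m * n))
    (c : Fin m → Fin n → F)
    (L' Tr : F → F)
    (hL' : ∀ x, L' x = ∑ i : Fin m, ∑ j : Fin n,
        (c i j * x) ^ 2 ^ (m * n - ((i : ℕ) + m * (j : ℕ))))
    (hTr : ∀ x, Tr x = ∑ i ∈ Finset.range n, x ^ (2 ^ m) ^ i) :
    ((∀ x, Tr x = 0 → Tr (L' x) = 0) ↔
      (∀ i : Fin m, (∑ j : Fin n, c i j) ^ 2 ^ m = ∑ j : Fin n, c i j)) ∧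
    ((∀ x, Tr x = 0 → Tr (L' x) = 0) →
      ((∀ x, Tr (L' x) = ∑ i : Fin m, ((∑ j : Fin n, c i j) * Tr x) ^ 2 ^ (m - (i : ℕ))) ∧
        ∀ g : F → F, (∀ x, Tr (L' x) = g (Tr x)) →
          ∀ y : F, y ^ 2 ^ m = y →
            g y = ∑ i : Fin m, ((∑ j : Fin n, c i j) * y) ^ 2 ^ (m - (i : ℕ)))) := by
  have : CharP F 2 := charP_of_card_eq_prime_pow hF
  rw [pow_mul] at hF
  obtain rfl : Tr = powTrace (2 ^ m) n := funext hTr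
  have hsum (x : F) : powTrace (2 ^ m) n (L' x) =
      ∑ i : Fin m, powTrace (2 ^ m) n ((∑ j : Fin n, c i j) * x) ^ 2 ^ (m - (i : ℕ)) := by
    rw [hL', powTrace_sum]
    refine Finset.sum_congr rfl fun i _ ↦ ?_
    rw [powTrace_sum, Finset.sum_mul, powTrace_sum, sum_pow_char_pow]
    refine Finset.sum_congr rfl fun j _ ↦ ?_
    have hij : m * n - ((i : ℕ) + m * (j : ℕ)) = m - i + m * (n - 1 - j) := by
      obtain ⟨k, hk⟩ := Nat.exists_eq_add_of_lt j.2
      have hk' : n - 1 - (j : ℕ) = k := by omega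
      have h1 : m * n = m * j + m * k + m := by simpa [mul_add] using congrArg (m * ·) hk
      have := i.2
      rw [hk', h1]
      omega
    rw [powTrace_pow_two_pow, hij, powTrace_pow_two_pow_add_mul hF]
  have hformula (hb : ∀ i : Fin m, (∑ j : Fin n, c i j) ^ 2 ^ m = ∑ j : Fin n, c i j) (x : F) :
      powTrace (2 ^ m) n (L' x) =
        ∑ i : Fin m, ((∑ j : Fin n, c i j) * powTrace (2 ^ m) n x) ^ 2 ^ (m - (i : ℕ)) := by
    simp only [hsum, powTrace_mul (hb _)]
  have hbase (h : ∀ x, powTrace (2 ^ m) n x = 0 → powTrace (2 ^ m) n (L' x) = 0) (i : Fin m) :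
      (∑ j : Fin n, c i j) ^ 2 ^ m = ∑ j : Fin n, c i j := by
    refine pow_eq_self_of_powTrace_mul_eq_zero hm hn hF fun x hx ↦ ?_
    refine eq_zero_of_sum_powTrace_mul_pow_eq_zero hn hF
      (B := fun i ↦ powTrace (2 ^ m) n ((∑ j : Fin n, c i j) * x)) (fun w ↦ ?_) i
    have hw := powTrace_pow_card hF w
    have h0 := h (powTrace (2 ^ m) n w * x) (by rw [powTrace_mul hw, hx, mul_zero])
    simpa only [hsum, mul_left_comm _ (powTrace (2 ^ m) n w), powTrace_mul hw] using h0
  refine ⟨⟨hbase, fun hb x hx ↦ ?_⟩, fun h ↦ ⟨hformula (hbase h), fun g hg y hy ↦ ?_⟩⟩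
  · simp [hformula hb, hx]
  · obtain ⟨x, rfl⟩ := exists_powTrace_eq hm hn hF hy
    rw [← hg, hformula (hbase h)]
end

section
/- Let L(x) = Σ_{i=0}^{m-1} L_i(x^{2^i}) where each L_i is a q-linear polynomial over F_{q^n}, and suppose L'(ker Tr) ⊆ ker Tr. Then L' induces a well-defined additive endomorphism of the quotient group F_{q^n}/ker Tr via ker Tr + α ↦ ker Tr + L'(α) for α ∈ F_{q^n}, and this endomorphism is an automorphism if and only if the map l(x) = Σ_{i=0}^{m-1} (L_i(1)·x)^{2^{m-i}} is an F_2-linear automorphism of F_q. -/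
open Finset Polynomial

section PowSum

variable {F : Type*} [Field F]

/-- The sum of the first `n` iterates of `x ↦ x ^ 2 ^ m`; on the field with `2 ^ (m * n)` elements
this is the trace to the subfield with `2 ^ m` elements. -/
def powSum (m n : ℕ) (x : F) : F := ∑ i ∈ range n, x ^ (2 ^ m) ^ i

variable {m n : ℕ}

lemma pow_two_pow_pow_of_fixed {a : F} (ha : a ^ 2 ^ m = a) (i : ℕ) : a ^ (2 ^ m) ^ i = a := by
  induction i with
  | zero => simp
  | succ i ih => rw [pow_succ, pow_mul, ih, ha]

lemma powSum_mul_of_fixed {a : F} (ha : a ^ 2 ^ m = a) (x : F) :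
    powSum m n (a * x) = a * powSum m n x := by
  simp only [powSum, mul_sum, mul_pow, pow_two_pow_pow_of_fixed ha]

section CharTwo

variable [CharP F 2]

lemma powSum_add (x y : F) : powSum m n (x + y) = powSum m n x + powSum m n y := by
  simp only [powSum, ← pow_mul, add_pow_char_pow, sum_add_distrib]

lemma powSum_sum {ι : Type*} (s : Finset ι) (f : ι → F) :
    powSum m n (∑ i ∈ s, f i) = ∑ i ∈ s, powSum m n (f i) :=
  map_sum (AddMonoidHom.mk' (powSum m n) powSum_add) f s

lemma powSum_pow_two_pow (x : F) (k : ℕ) :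
    powSum m n (x ^ 2 ^ k) = powSum m n x ^ 2 ^ k := by
  simp only [powSum, sum_pow_char_pow, ← pow_mul, mul_comm]

lemma powSum_sub (x y : F) : powSum m n (x - y) = powSum m n x - powSum m n y :=
  map_sub (AddMonoidHom.mk' (powSum m n) powSum_add) x y

end CharTwo

/-- The polynomial whose evaluation is `powSum`. -/
noncomputable def powSumPoly (F : Type*) [Field F] (m n : ℕ) : F[X] :=
  ∑ i ∈ range n, X ^ (2 ^ m) ^ i

lemma eval_powSumPoly (x : F) : (powSumPoly F m n).eval x = powSum m n x := by
  simp [powSumPoly, powSum, eval_finsetSum]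

lemma natDegree_powSumPoly (hm : 0 < m) :
    (powSumPoly F m (n + 1)).natDegree = (2 ^ m) ^ n := by
  have hq : 1 < 2 ^ m := Nat.one_lt_two_pow hm.ne'
  rw [powSumPoly, sum_range_succ, natDegree_add_eq_right_of_degree_lt, natDegree_X_pow]
  refine (degree_sum_le _ _).trans_lt ?_
  rw [degree_X_pow, Finset.sup_lt_iff (WithBot.bot_lt_coe _)]
  intro i hi
  rw [degree_X_pow]
  exact_mod_cast Nat.pow_lt_pow_right hq (mem_range.1 hi)

section Finite

variable [Fintype F] (hF : Fintype.card F = 2 ^ (m * n))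
include hF

lemma powSum_fixed [CharP F 2] (x : F) : powSum m n x ^ 2 ^ m = powSum m n x := by
  have h : x ^ (2 ^ m) ^ n = x := by rw [← pow_mul, ← hF, FiniteField.pow_card]
  have h1 := sum_range_succ (fun i => x ^ (2 ^ m) ^ i) n
  rw [sum_range_succ', h, pow_zero, pow_one] at h1
  simpa only [powSum, sum_pow_char_pow, ← pow_mul, ← pow_add, mul_add_one] using add_right_cancel h1

lemma eq_zero_of_eval_powSum_eq_zero (hm : 0 < m) (hn : 0 < n) {P : F[X]}
    (hP : P.natDegree < 2 ^ m) (h : ∀ x : F, P.eval (powSum m n x) = 0) : P = 0 := by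
  obtain ⟨n, rfl⟩ := Nat.exists_eq_succ_of_ne_zero hn.ne'
  have hdeg := natDegree_powSumPoly (F := F) (n := n) hm
  have hcomp : P.comp (powSumPoly F m (n + 1)) = 0 := by
    refine eq_zero_of_natDegree_lt_card_of_eval_eq_zero _ Function.injective_id
      (fun x => ?_) ?_
    · rw [eval_comp, id, eval_powSumPoly, h]
    · rw [natDegree_comp, hdeg, hF, pow_mul, pow_succ']
      exact Nat.mul_lt_mul_of_pos_right hP (by positivity)
  rcases comp_eq_zero_iff.1 hcomp with h | ⟨-, h⟩
  · exact h
  · rw [h, natDegree_C] at hdeg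
    exact absurd hdeg.symm (by positivity)

lemma exists_powSum_eq_one [CharP F 2] (hm : 0 < m) (hn : 0 < n) :
    ∃ x : F, powSum m n x = 1 := by
  obtain ⟨x, hx⟩ : ∃ x : F, powSum m n x ≠ 0 := by
    by_contra! h
    refine X_ne_zero (eq_zero_of_eval_powSum_eq_zero hF hm hn (P := X) ?_ (by simpa using h))
    simpa using hm.ne'
  refine ⟨(powSum m n x)⁻¹ * x, ?_⟩
  rw [powSum_mul_of_fixed (by rw [inv_pow, powSum_fixed hF]), inv_mul_cancel₀ hx]

lemma fixed_of_mul_mem_ker_powSum [CharP F 2] (hm : 0 < m) (hn : 0 < n) {d : F}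
    (hd : ∀ x : F, powSum m n x = 0 → powSum m n (d * x) = 0) : d ^ 2 ^ m = d := by
  obtain ⟨u, hu⟩ := exists_powSum_eq_one hF hm hn
  suffices d = powSum m n (d * u) by rw [this, powSum_fixed hF]
  by_contra hne
  have hne := sub_ne_zero.2 hne
  have key (x : F) : powSum m n (d * x) = powSum m n (d * u) * powSum m n x := by
    have h := hd (x - powSum m n x * u) <| by
      rw [powSum_sub, powSum_mul_of_fixed (powSum_fixed hF x), hu, mul_one, sub_self]
    rw [mul_sub, mul_left_comm, powSum_sub, powSum_mul_of_fixed (powSum_fixed hF x)] at h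
    rw [sub_eq_zero.1 h, mul_comm]
  have h : powSum m n ((d - powSum m n (d * u)) * ((d - powSum m n (d * u))⁻¹ * u)) = 0 := by
    rw [sub_mul, powSum_sub, key, powSum_mul_of_fixed (powSum_fixed hF _), sub_self]
  rw [mul_inv_cancel_left₀ hne, hu] at h
  exact one_ne_zero h

lemma eq_zero_of_sum_pow_two_pow_eq_zero [CharP F 2] (hm : 0 < m) (hn : 0 < n) {t : Fin m → F}
    (ht : ∀ i, t i ^ 2 ^ m = t i)
    (h : ∀ x : F, ∑ i : Fin m, (powSum m n x * t i) ^ 2 ^ (m - (i : ℕ)) = 0) (i : Fin m) :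
    t i = 0 := by
  let e : Fin m → ℕ := fun i => if (i : ℕ) = 0 then 0 else m - i
  have he {i j : Fin m} : e i = e j ↔ i = j := by
    simp only [e, Fin.ext_iff]
    split_ifs <;> lia
  have hpow (a : F) (ha : a ^ 2 ^ m = a) (i : Fin m) : a ^ 2 ^ (m - (i : ℕ)) = a ^ 2 ^ e i := by
    by_cases hi : (i : ℕ) = 0 <;> simp [e, hi, ha]
  have hP : ∑ i : Fin m, C (t i ^ 2 ^ e i) * X ^ 2 ^ e i = (0 : F[X]) := by
    refine eq_zero_of_eval_powSum_eq_zero hF hm hn ?_ fun x => ?_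
    · refine (natDegree_sum_le_of_forall_le (n := 2 ^ (m - 1)) _ _ fun i _ => ?_).trans_lt
        (Nat.pow_lt_pow_right one_lt_two (by lia))
      refine (natDegree_C_mul_X_pow_le _ _).trans (Nat.pow_le_pow_right two_pos ?_)
      simp only [e]
      split_ifs <;> lia
    · rw [eval_finsetSum, ← h x]
      refine sum_congr rfl fun i _ => ?_
      rw [hpow _ (by rw [mul_pow, powSum_fixed hF, ht]), mul_pow, mul_comm]
      simp
  have hcoeff := congrArg (fun P : F[X] => P.coeff (2 ^ e i)) hP
  simp only [finsetSum_coeff, coeff_C_mul_X_pow, coeff_zero, Nat.pow_right_inj one_lt_two,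
    he, sum_ite_eq, mem_univ, if_true] at hcoeff
  exact eq_zero_of_pow_eq_zero hcoeff

end Finite

end PowSum


/-- Let `q = 2^m`, `F` the field with `q^n` elements,
`L(x) = Σ_{i<m} L_i(x^(2^i))` with `L_i(x) = Σ_{j<n} c i j · x^(q^j)` `q`-linear, and suppose
`L'(ker Tr) ⊆ ker Tr`.  Let `K` be the additive subgroup `ker Tr`.  Then `L'` induces a
well-defined additive endomorphism `φ` of `F ⧸ K` with `φ(α + K) = L'(α) + K`, and `φ` is an
automorphism iff `l(x) = Σ_{i<m} (L_i(1)·x)^(2^(m-i))` is an `F_2`-linear (i.e. additive)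
bijection of `F_q`. -/
theorem stmt_7 (m n : ℕ) (hm : 0 < m) (hn : 0 < n)
    (F : Type*) [Field F] [Fintype F] (hF : Fintype.card F = 2 ^ (m * n))
    (c : Fin m → Fin n → F)
    (L' Tr ell : F → F)
    (hL' : ∀ x, L' x = ∑ i : Fin m, ∑ j : Fin n,
        (c i j * x) ^ 2 ^ (m * n - ((i : ℕ) + m * (j : ℕ))))
    (hTr : ∀ x, Tr x = ∑ i ∈ Finset.range n, x ^ (2 ^ m) ^ i)
    (hell : ∀ x, ell x = ∑ i : Fin m, ((∑ j : Fin n, c i j) * x) ^ 2 ^ (m - (i : ℕ)))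
    (hinv : ∀ x, Tr x = 0 → Tr (L' x) = 0)
    (K : AddSubgroup F) (hK : ∀ x, x ∈ K ↔ Tr x = 0) :
    ∃ φ : F ⧸ K →+ F ⧸ K,
      (∀ α : F, φ (QuotientAddGroup.mk α) = QuotientAddGroup.mk (L' α)) ∧
      (Function.Bijective φ ↔
        (Set.BijOn ell {x : F | x ^ 2 ^ m = x} {x : F | x ^ 2 ^ m = x} ∧
          ∀ x y : F, x ^ 2 ^ m = x → y ^ 2 ^ m = y → ell (x + y) = ell x + ell y)) := by
  have : CharP F 2 := charP_of_card_eq_prime_pow hF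
  obtain rfl : Tr = powSum m n := funext hTr
  have hfix := powSum_fixed hF
  obtain ⟨d, hd⟩ : ∃ d : Fin m → F, ∀ i, d i = ∑ j : Fin n, c i j := ⟨_, fun _ => rfl⟩
  have hL'add (x y : F) : L' (x + y) = L' x + L' y := by
    simp only [hL', mul_add, add_pow_char_pow, sum_add_distrib]
  have helladd (x y : F) : ell (x + y) = ell x + ell y := by
    simp only [hell, mul_add, add_pow_char_pow, sum_add_distrib]
  have hTrL' (x : F) :
      powSum m n (L' x) = ∑ i : Fin m, powSum m n (d i * x) ^ 2 ^ (m - (i : ℕ)) := by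
    simp only [hL', powSum_sum, powSum_pow_two_pow, hd, sum_mul, sum_pow_char_pow]
    refine sum_congr rfl fun i _ => sum_congr rfl fun j _ => ?_
    have hexp : m * n - ((i : ℕ) + m * (j : ℕ)) = m * (n - 1 - j) + (m - i) := by
      obtain ⟨k, hk⟩ := Nat.exists_eq_add_of_lt j.2
      have hmn : m * n = m * j + m * k + m := by rw [← mul_add, ← mul_add_one, ← hk]
      rw [show n - 1 - j = k by lia, hmn]
      lia
    rw [hexp, pow_add, pow_mul 2 m, pow_mul _ ((2 ^ m) ^ _), pow_two_pow_pow_of_fixed (hfix _)]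
  have hdfix (i : Fin m) : d i ^ 2 ^ m = d i := by
    refine fixed_of_mul_mem_ker_powSum hF hm hn fun x hx => ?_
    refine eq_zero_of_sum_pow_two_pow_eq_zero hF hm hn (t := fun i => powSum m n (d i * x))
      (fun i => hfix _) (fun y => ?_) i
    have h := hinv (powSum m n y * x) (by rw [powSum_mul_of_fixed (hfix y), hx, mul_zero])
    rw [hTrL'] at h
    simpa only [mul_left_comm (d _), powSum_mul_of_fixed (hfix y)] using h
  have hTrL'ell (x : F) : powSum m n (L' x) = ell (powSum m n x) := by
    simp only [hTrL', hell, ← hd, powSum_mul_of_fixed (hdfix _)]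
  have hsurj (y : F) (hy : y ^ 2 ^ m = y) : ∃ x, powSum m n x = y := by
    obtain ⟨u, hu⟩ := exists_powSum_eq_one hF hm hn
    exact ⟨y * u, by rw [powSum_mul_of_fixed hy, hu, mul_one]⟩
  have hmk (x y : F) : (x : F ⧸ K) = y ↔ powSum m n x = powSum m n y := by
    rw [QuotientAddGroup.eq_iff_sub_mem, hK, powSum_sub, sub_eq_zero]
  have hmaps : Set.MapsTo ell {x : F | x ^ 2 ^ m = x} {x : F | x ^ 2 ^ m = x} := by
    intro y hy
    obtain ⟨x, rfl⟩ := hsurj y hy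
    rw [← hTrL'ell]
    exact hfix _
  refine ⟨QuotientAddGroup.map K K (AddMonoidHom.mk' L' hL'add) fun x hx => ?_,
    fun α => rfl, ?_, ?_⟩
  · exact (hK _).2 (hinv x ((hK x).1 hx))
  · rintro ⟨hinj, hsur⟩
    refine ⟨⟨hmaps, ?_, ?_⟩, fun x y _ _ => helladd x y⟩
    · intro y hy z hz hyz
      obtain ⟨x, rfl⟩ := hsurj y hy
      obtain ⟨w, rfl⟩ := hsurj z hz
      rw [← hTrL'ell, ← hTrL'ell, ← hmk] at hyz
      exact (hmk _ _).1 (hinj hyz)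
    · intro y hy
      obtain ⟨x, rfl⟩ := hsurj y hy
      obtain ⟨w, hw⟩ := hsur x
      obtain ⟨w, rfl⟩ := QuotientAddGroup.mk_surjective w
      exact ⟨powSum m n w, hfix w, by rw [← hTrL'ell]; exact (hmk _ _).1 hw⟩
  · rintro ⟨⟨-, hinj, hsur⟩, -⟩
    constructor
    · intro a b hab
      obtain ⟨x, rfl⟩ := QuotientAddGroup.mk_surjective a
      obtain ⟨y, rfl⟩ := QuotientAddGroup.mk_surjective b
      have h := (hmk (L' x) (L' y)).1 hab
      rw [hTrL'ell, hTrL'ell] at h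
      exact (hmk _ _).2 (hinj (hfix x) (hfix y) h)
    · intro a
      obtain ⟨x, rfl⟩ := QuotientAddGroup.mk_surjective a
      obtain ⟨y, hy, hyx⟩ := hsur (hfix x)
      obtain ⟨w, rfl⟩ := hsurj y hy
      exact ⟨w, (hmk (L' w) x).2 (by rw [hTrL'ell, hyx])⟩
end
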